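/- The image ω + O_{g,n}(V) of the conformal vector ω is a central element of the associative algebra A_{g,n}(V). -/

import Mathlib

/-
Common framework for formalizing
"Twisted representations of vertex operator algebras and associative algebras"
by C. Dong, H. Li, G. Mason.

We formalize a vertex operator algebra `V` over `ℂ` through its modes
`u_m = mode u m` (`m : ℤ`), vacuum `𝟏`, conformal vector `ω` (so that
`L(n) = ω_{n+1}`), a weight grading `wtSpace`, and the Borcherds identity.
An automorphism `g` of finite order `T` gives eigenspaces
`V^r = eigSpace V g T r`.  For `n = l + i/T` the subspace `O_{g,n}(V)` is
`Ogn V g T l i`, the product `*_{g,n}` is `starMul V g T l`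
(it only depends on `l`), and `A_{g,n}(V) = V.carrier ⧸ Ogn V g T l i`.
-/

noncomputable section

open scoped BigOperators

namespace DLM

/-- Generalized binomial coefficient `binom(α, j)` for a rational `α`. -/
def qchoose (α : ℚ) (j : ℕ) : ℚ :=
  (∏ k ∈ Finset.range j, (α - (k : ℚ))) / (Nat.factorial j : ℚ)

/-- A vertex operator algebra over `ℂ`, given by its modes `u_m v = mode u m v`
(the coefficients of `Y(u,z)v`), the vacuum `𝟏`, the conformal vector `ω`
(with `L(n) = ω_{n+1}`), and the integer weight grading. -/
structure VOA where
  carrier : Type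
  [acg : AddCommGroup carrier]
  [mod : Module ℂ carrier]
  mode : carrier →ₗ[ℂ] (ℤ → carrier →ₗ[ℂ] carrier)
  vacuum : carrier
  conformal : carrier
  wtSpace : ℤ → Submodule ℂ carrier
  [decomp : DirectSum.Decomposition wtSpace]
  findim : ∀ k : ℤ, FiniteDimensional ℂ (wtSpace k)
  bounded_below : ∃ N : ℤ, ∀ k : ℤ, k < N → wtSpace k = ⊥
  trunc : ∀ u v : carrier, ∃ N : ℤ, ∀ m : ℤ, N ≤ m → mode u m v = 0
  vacuum_wt : vacuum ∈ wtSpace 0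
  conformal_wt : conformal ∈ wtSpace 2
  vacuum_mode : ∀ (m : ℤ) (v : carrier), mode vacuum m v = if m = -1 then v else 0
  creation₁ : ∀ u : carrier, mode u (-1) vacuum = u
  creation₂ : ∀ (u : carrier) (m : ℤ), 0 ≤ m → mode u m vacuum = 0
  L0_grading : ∀ (k : ℤ), ∀ v ∈ wtSpace k, mode conformal 1 v = (k : ℂ) • v
  mode_grading : ∀ (a b m : ℤ) (u v : carrier), u ∈ wtSpace a → v ∈ wtSpace b →
    mode u m v ∈ wtSpace (a + b - m - 1)
  Lneg1_mode : ∀ (u : carrier) (m : ℤ),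
    mode (mode conformal 0 u) m = (-(m : ℂ)) • (mode u (m - 1))
  borcherds : ∀ (u v w : carrier) (p q s : ℤ),
    ∑ᶠ j : ℕ, ((qchoose (p : ℚ) j : ℚ) : ℂ) • mode (mode u (s + j) v) (p + q - j) w =
    ∑ᶠ j : ℕ, ((-1 : ℂ) ^ j * ((qchoose (s : ℚ) j : ℚ) : ℂ)) •
      (mode u (p + s - j) (mode v (q + j) w)
        - ((-1 : ℂ) ^ s) • mode v (q + s - j) (mode u (p + j) w))

attribute [instance] VOA.acg VOA.mod VOA.decomp

namespace VOA

/-- Projection of `u` onto its weight `k` homogeneous component. -/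
def proj (V : VOA) (k : ℤ) (u : V.carrier) : V.carrier :=
  (((DirectSum.decompose V.wtSpace u) k : V.wtSpace k) : V.carrier)

/-- `res V α β u v = Res_z Y(u,z)v (1+z)^α z^{-β}
  = ∑_{j ≥ 0} binom(α, j) u_{j - β} v`. -/
def res (V : VOA) (α : ℚ) (β : ℤ) (u v : V.carrier) : V.carrier :=
  ∑ᶠ j : ℕ, ((qchoose α j : ℚ) : ℂ) • V.mode u ((j : ℤ) - β) v

end VOA

/-- An automorphism of a vertex operator algebra. -/
structure VOAAut (V : VOA) where
  lin : V.carrier ≃ₗ[ℂ] V.carrier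
  map_vacuum : lin V.vacuum = V.vacuum
  map_conformal : lin V.conformal = V.conformal
  map_mode : ∀ (u : V.carrier) (m : ℤ) (v : V.carrier),
    lin (V.mode u m v) = V.mode (lin u) m (lin v)
  map_wt : ∀ (k : ℤ) (u : V.carrier), u ∈ V.wtSpace k ↔ lin u ∈ V.wtSpace k

/-- The inverse automorphism `g⁻¹`. -/
def VOAAut.symm {V : VOA} (g : VOAAut V) : VOAAut V where
  lin := g.lin.symm
  map_vacuum := g.lin.injective (by rw [LinearEquiv.apply_symm_apply, g.map_vacuum])
  map_conformal := g.lin.injective (by rw [LinearEquiv.apply_symm_apply, g.map_conformal])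
  map_mode := fun u m v => g.lin.injective (by
    rw [LinearEquiv.apply_symm_apply, g.map_mode, LinearEquiv.apply_symm_apply,
      LinearEquiv.apply_symm_apply])
  map_wt := fun k u => by
    have h := (g.map_wt k (g.lin.symm u)).symm
    rwa [LinearEquiv.apply_symm_apply] at h

/-- The eigenspace `V^r = {v ∈ V | g v = e^{-2πir/T} v}`. -/
def eigSpace (V : VOA) (g : VOAAut V) (T r : ℕ) : Submodule ℂ V.carrier where
  carrier := {v | g.lin v =
    Complex.exp (-(2 * (Real.pi : ℂ) * Complex.I * (r : ℂ)) / (T : ℂ)) • v}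
  add_mem' := fun {a b} ha hb => by
    simp only [Set.mem_setOf_eq] at *
    rw [map_add, ha, hb, smul_add]
  zero_mem' := by simp
  smul_mem' := fun c a ha => by
    simp only [Set.mem_setOf_eq] at *
    rw [map_smul, ha, smul_comm]

/-- `δ_i(r)`: equals `1` if `r ≤ i` or `r = T`, and `0` otherwise. -/
def deltaI (T i r : ℕ) : ℕ := if r ≤ i ∨ r = T then 1 else 0

/-- `O_{g,n}(V)` for `n = l + i/T`: the span of all `L(-1)u + L(0)u` and all
`u ∘_{g,n} v = Res_z Y(u,z)v (1+z)^{wt u - 1 + δ_i(r) + l + r/T}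
 / z^{2l + δ_i(r) + δ_i(T-r)}` for homogeneous `u ∈ V^r`. -/
def Ogn (V : VOA) (g : VOAAut V) (T l i : ℕ) : Submodule ℂ V.carrier :=
  Submodule.span ℂ
    ({x | ∃ u : V.carrier, x = V.mode V.conformal 0 u + V.mode V.conformal 1 u} ∪
     {x | ∃ r : ℕ, r < T ∧ ∃ (k : ℤ) (u v : V.carrier),
        u ∈ V.wtSpace k ∧ u ∈ eigSpace V g T r ∧
        x = V.res ((k : ℚ) - 1 + (deltaI T i r : ℚ) + (l : ℚ) + (r : ℚ) / (T : ℚ))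
              (2 * (l : ℤ) + (deltaI T i r : ℤ) + (deltaI T i (T - r) : ℤ)) u v})

/-- The product `u *_{g,n} v` for `u` homogeneous of weight `k` in `V^0`:
`∑_{m=0}^{l} (-1)^m binom(m+l, l) Res_z Y(u,z) (1+z)^{wt u + l} z^{-(l+m+1)} v`. -/
def starFor (V : VOA) (l : ℕ) (k : ℤ) (u v : V.carrier) : V.carrier :=
  ∑ m ∈ Finset.range (l + 1),
    ((-1 : ℂ) ^ m * (Nat.choose (m + l) l : ℂ)) •
      V.res ((k : ℚ) + (l : ℚ)) ((l : ℤ) + (m : ℤ) + 1) u v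

/-- Projection onto the eigenspace `V^r` of the finite order automorphism `g`. -/
def eigProj (V : VOA) (g : VOAAut V) (T r : ℕ) (v : V.carrier) : V.carrier :=
  (T : ℂ)⁻¹ • ∑ t ∈ Finset.range T,
    Complex.exp ((2 * (Real.pi : ℂ) * Complex.I * (r : ℂ) * (t : ℂ)) / (T : ℂ)) •
      ((g.lin ^ t) v)

/-- The bilinear extension of `*_{g,n}` to all of `V` (it vanishes when the first
argument is homogeneous in `V^r`, `r ≠ 0`, and only depends on `l`). -/
def starMul (V : VOA) (g : VOAAut V) (T l : ℕ) (u v : V.carrier) : V.carrier :=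
  ∑ᶠ k : ℤ, starFor V l k (eigProj V g T 0 (V.proj k u)) v

/-- The subspace `O_{1,l}(V^0)` of the untwisted theory of the fixed point
subalgebra `V^0` (all `δ` terms equal `1`), viewed inside `V`. -/
def OgnV0 (V : VOA) (g : VOAAut V) (T l : ℕ) : Submodule ℂ V.carrier :=
  Submodule.span ℂ
    ({x | ∃ u ∈ eigSpace V g T 0, x = V.mode V.conformal 0 u + V.mode V.conformal 1 u} ∪
     {x | ∃ (k : ℤ) (u v : V.carrier),
        u ∈ V.wtSpace k ∧ u ∈ eigSpace V g T 0 ∧ v ∈ eigSpace V g T 0 ∧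
        x = V.res ((k : ℚ) + (l : ℚ)) (2 * (l : ℤ) + 2) u v})

/-- `e^{L(1)} v` (where `L(1) = ω_2`). -/
def expL1 (V : VOA) (v : V.carrier) : V.carrier :=
  ∑ᶠ j : ℕ, ((Nat.factorial j : ℂ))⁻¹ • ((fun w => V.mode V.conformal 2 w)^[j] v)

/-- The map `φ : v ↦ e^{L(1)} (-1)^{L(0)} v`. -/
def phiMap (V : VOA) (v : V.carrier) : V.carrier :=
  ∑ᶠ k : ℤ, ((-1 : ℂ) ^ k) • expL1 V (V.proj k v)

/-- `l`-component of `n - 1/T` when `n = l + i/T`. -/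
def predL (l i : ℕ) : ℕ := if i = 0 then l - 1 else l

/-- `i`-component of `n - 1/T` when `n = l + i/T`. -/
def predI (T i : ℕ) : ℕ := if i = 0 then T - 1 else i - 1

/-- The rational number `n = l + i/T`. -/
def nval (T l i : ℕ) : ℚ := (l : ℚ) + (i : ℚ) / (T : ℚ)

/-- A weak `g`-twisted `V`-module: modes `v_m = act v m` for `m ∈ (1/T)ℤ ⊆ ℚ`,
satisfying the truncation, vacuum and twisted Borcherds (Jacobi) identities. -/
structure TwModule (V : VOA) (g : VOAAut V) (T : ℕ) where
  carrier : Type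
  [acg : AddCommGroup carrier]
  [mod : Module ℂ carrier]
  act : V.carrier →ₗ[ℂ] (ℚ → carrier →ₗ[ℂ] carrier)
  act_eig : ∀ r : ℕ, r < T → ∀ u ∈ eigSpace V g T r, ∀ m : ℚ,
    (¬ ∃ z : ℤ, m = (z : ℚ) + (r : ℚ) / (T : ℚ)) → act u m = 0
  act_trunc : ∀ (u : V.carrier) (x : carrier), ∃ N : ℤ, ∀ m : ℚ, (N : ℚ) ≤ m → act u m x = 0
  act_vacuum : ∀ (m : ℚ) (x : carrier), act V.vacuum m x = if m = -1 then x else 0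
  jacobi : ∀ r s : ℕ, r < T → s < T → ∀ u ∈ eigSpace V g T r, ∀ v ∈ eigSpace V g T s,
    ∀ (a b c : ℤ) (x : carrier),
    ∑ᶠ j : ℕ, ((qchoose ((r : ℚ) / (T : ℚ) + (a : ℚ)) j : ℚ) : ℂ) •
        act (V.mode u (c + j) v) ((r : ℚ) / (T : ℚ) + (s : ℚ) / (T : ℚ) + a + b - j) x =
    ∑ᶠ j : ℕ, ((-1 : ℂ) ^ j * ((qchoose (c : ℚ) j : ℚ) : ℂ)) •
        (act u ((r : ℚ) / (T : ℚ) + a + c - j) (act v ((s : ℚ) / (T : ℚ) + b + j) x)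
          - ((-1 : ℂ) ^ c) •
            act v ((s : ℚ) / (T : ℚ) + b + c - j) (act u ((r : ℚ) / (T : ℚ) + a + j) x))

attribute [instance] TwModule.acg TwModule.mod

namespace TwModule

variable {V : VOA} {g : VOAAut V} {T : ℕ}

/-- The operator `o_p(a) = a_{wt a - 1 - p}`, extended linearly from homogeneous `a`. -/
def oactL (M : TwModule V g T) (p : ℚ) (a : V.carrier) : M.carrier →ₗ[ℂ] M.carrier :=
  ∑ᶠ k : ℤ, M.act (V.proj k a) ((k : ℚ) - 1 - p)

/-- `Ω_n(M) = {x ∈ M | V[g]_{-k} x = 0 for all k > n}`, i.e. `v_m x = 0` whenever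
`v` is homogeneous of weight `d` and `d - 1 - m < -n`. -/
def Omega (M : TwModule V g T) (n : ℚ) : Submodule ℂ M.carrier where
  carrier := {x | ∀ (k : ℤ) (u : V.carrier), u ∈ V.wtSpace k → ∀ m : ℚ,
    (k : ℚ) - 1 + n < m → M.act u m x = 0}
  add_mem' := fun {a b} ha hb => by
    intro k u hu m hm
    rw [map_add, ha k u hu m hm, hb k u hu m hm, add_zero]
  zero_mem' := fun k u hu m hm => map_zero _
  smul_mem' := fun c a ha => by
    intro k u hu m hm
    rw [map_smul, ha k u hu m hm, smul_zero]

theorem mem_Omega {M : TwModule V g T} {n : ℚ} {x : M.carrier} :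
    x ∈ M.Omega n ↔ ∀ (k : ℤ) (u : V.carrier), u ∈ V.wtSpace k → ∀ m : ℚ,
      (k : ℚ) - 1 + n < m → M.act u m x = 0 := Iff.rfl

/-- `Ω_{n-1/T}(M)`, viewed as a submodule of `Ω_n(M)`. -/
def OmegaSub (M : TwModule V g T) (n : ℚ) : Submodule ℂ (M.Omega n) :=
  (M.Omega (n - 1 / (T : ℚ))).comap (M.Omega n).subtype

/-- The quotient `Ω_n(M)/Ω_{n-1/T}(M)`. -/
abbrev OmegaQ (M : TwModule V g T) (n : ℚ) :=
  (M.Omega n) ⧸ (M.OmegaSub n)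

open Classical in
/-- The action of `o(a)` on `Ω_n(M)` (it does preserve `Ω_n(M)`). -/
def oactOmega (M : TwModule V g T) (n : ℚ) (a : V.carrier) :
    M.Omega n →ₗ[ℂ] M.Omega n :=
  if h : ∀ x ∈ M.Omega n, M.oactL 0 a x ∈ M.Omega n then (M.oactL 0 a).restrict h else 0

open Classical in
/-- The induced action of `o(a)` on `Ω_n(M)/Ω_{n-1/T}(M)`. -/
def oactQ (M : TwModule V g T) (n : ℚ) (a : V.carrier) :
    M.OmegaQ n →ₗ[ℂ] M.OmegaQ n :=
  if h : M.OmegaSub n ≤ (M.OmegaSub n).comap (M.oactOmega n a) then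
    Submodule.mapQ _ _ (M.oactOmega n a) h
  else 0

end TwModule

/-- A morphism of weak `g`-twisted `V`-modules. -/
structure TwHom {V : VOA} {g : VOAAut V} {T : ℕ} (M N : TwModule V g T) where
  toLin : M.carrier →ₗ[ℂ] N.carrier
  comm : ∀ (u : V.carrier) (m : ℚ) (x : M.carrier), toLin (M.act u m x) = N.act u m (toLin x)

namespace TwHom

variable {V : VOA} {g : VOAAut V} {T : ℕ}

def id (M : TwModule V g T) : TwHom M M := ⟨LinearMap.id, fun _ _ _ => rfl⟩

def comp {M N P : TwModule V g T} (f' : TwHom N P) (f : TwHom M N) : TwHom M P :=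
  ⟨f'.toLin.comp f.toLin, fun u m x => by
    simp only [LinearMap.comp_apply, f.comm, f'.comm]⟩

theorem mapsOmega {M N : TwModule V g T} (f : TwHom M N) (n : ℚ) :
    ∀ x ∈ M.Omega n, f.toLin x ∈ N.Omega n := fun x hx k u hu m hm => by
  rw [← f.comm, hx k u hu m hm, map_zero]

/-- The restriction of a morphism to `Ω_n`. -/
def omegaMap {M N : TwModule V g T} (f : TwHom M N) (n : ℚ) :
    M.Omega n →ₗ[ℂ] N.Omega n :=
  f.toLin.restrict (f.mapsOmega n)

/-- The induced map `Ω_n(M)/Ω_{n-1/T}(M) → Ω_n(N)/Ω_{n-1/T}(N)`. -/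
def omegaQMap {M N : TwModule V g T} (f : TwHom M N) (n : ℚ) :
    M.OmegaQ n →ₗ[ℂ] N.OmegaQ n :=
  Submodule.mapQ _ _ (f.omegaMap n) (fun x hx => f.mapsOmega (n - 1 / (T : ℚ)) x.1 hx)

end TwHom

/-- An admissible (`(1/T)ℤ≥0`-graded) `g`-twisted `V`-module. -/
structure AdmTwModule (V : VOA) (g : VOAAut V) (T : ℕ) extends TwModule V g T where
  grade : ℚ → Submodule ℂ carrier
  [gdecomp : DirectSum.Decomposition grade]
  grade_support : ∀ q : ℚ, (q < 0 ∨ ¬ ∃ z : ℤ, q = (z : ℚ) / (T : ℚ)) → grade q = ⊥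
  grade_act : ∀ (k : ℤ) (u : V.carrier), u ∈ V.wtSpace k → ∀ (m p : ℚ), ∀ x ∈ grade p,
    act u m x ∈ grade (p + (k : ℚ) - m - 1)

attribute [instance] AdmTwModule.gdecomp

namespace AdmTwModule

variable {V : VOA} {g : VOAAut V} {T : ℕ}

/-- A submodule invariant under all twisted vertex operators. -/
def InvSub (M : AdmTwModule V g T) (W : Submodule ℂ M.carrier) : Prop :=
  ∀ (u : V.carrier) (m : ℚ), ∀ x ∈ W, M.act u m x ∈ W

/-- A graded submodule (closed under homogeneous components). -/
def GradedSub (M : AdmTwModule V g T) (W : Submodule ℂ M.carrier) : Prop :=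
  ∀ x ∈ W, ∀ q : ℚ, (((DirectSum.decompose M.grade x) q : M.grade q) : M.carrier) ∈ W

/-- A simple (irreducible) admissible module: nonzero, with no proper nonzero
graded submodule. -/
def IsSimple (M : AdmTwModule V g T) : Prop :=
  (∃ x : M.carrier, x ≠ 0) ∧
  ∀ W : Submodule ℂ M.carrier, M.InvSub W → M.GradedSub W → W = ⊥ ∨ W = ⊤

/-- `W` is a simple (irreducible) admissible submodule of `M`. -/
def SubSimple (M : AdmTwModule V g T) (W : Submodule ℂ M.carrier) : Prop :=
  W ≠ ⊥ ∧ ∀ W' : Submodule ℂ M.carrier, W' ≤ W → M.InvSub W' → M.GradedSub W' →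
    W' = ⊥ ∨ W' = W

/-- `M` is a direct sum of irreducible admissible submodules. -/
def CompletelyReducible (M : AdmTwModule V g T) : Prop :=
  ∃ (κ : Type) (S : κ → Submodule ℂ M.carrier),
    (∀ j, M.InvSub (S j) ∧ M.GradedSub (S j) ∧ M.SubSimple (S j)) ∧
    iSupIndep S ∧ (⨆ j, S j) = ⊤

end AdmTwModule

/-- `V` is `g`-rational: every admissible `g`-twisted module is a direct sum of
irreducible admissible `g`-twisted modules. -/
def GRational (V : VOA) (g : VOAAut V) (T : ℕ) : Prop :=
  ∀ M : AdmTwModule V g T, M.CompletelyReducible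

/-- An ordinary `g`-twisted `V`-module: graded by `L(0)`-eigenvalues with
finite dimensional pieces and spectrum bounded below in each congruence class
mod `(1/T)ℤ`. -/
structure OrdTwModule (V : VOA) (g : VOAAut V) (T : ℕ) extends TwModule V g T where
  egrade : ℂ → Submodule ℂ carrier
  [edecomp : DirectSum.Decomposition egrade]
  egrade_L0 : ∀ lam : ℂ, ∀ x ∈ egrade lam, act V.conformal 1 x = lam • x
  egrade_findim : ∀ lam : ℂ, FiniteDimensional ℂ (egrade lam)
  egrade_bounded : ∀ lam : ℂ, ∃ N : ℤ, ∀ m : ℤ, m ≤ N →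
    egrade (lam + (m : ℂ) / (T : ℂ)) = ⊥

attribute [instance] OrdTwModule.edecomp

/-- A module over the associative algebra `A_{g,n}(V)` (with `n = l + i/T`),
given as a representation of `V` that kills `O_{g,n}(V)`, takes the vacuum to
the identity, and turns `*_{g,n}` into composition. -/
structure AMod (V : VOA) (g : VOAAut V) (T l i : ℕ) where
  carrier : Type
  [acg : AddCommGroup carrier]
  [mod : Module ℂ carrier]
  rho : V.carrier →ₗ[ℂ] (carrier →ₗ[ℂ] carrier)
  rho_O : ∀ a ∈ Ogn V g T l i, rho a = 0
  rho_one : rho V.vacuum = LinearMap.id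
  rho_star : ∀ a b : V.carrier, rho (starMul V g T l a b) = (rho a).comp (rho b)

attribute [instance] AMod.acg AMod.mod

namespace AMod

variable {V : VOA} {g : VOAAut V} {T l i : ℕ}

/-- `U` does not factor through `A_{g,n-1/T}(V)`. -/
def NotFactor (U : AMod V g T l i) : Prop :=
  ∃ a ∈ Ogn V g T (predL l i) (predI T i), U.rho a ≠ 0

/-- An invariant subspace. -/
def SubInv (U : AMod V g T l i) (W : Submodule ℂ U.carrier) : Prop :=
  ∀ a : V.carrier, ∀ x ∈ W, U.rho a x ∈ W

/-- `W` is a simple `A_{g,n}(V)`-submodule of `U`. -/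
def SubSimple (U : AMod V g T l i) (W : Submodule ℂ U.carrier) : Prop :=
  W ≠ ⊥ ∧ ∀ W' : Submodule ℂ U.carrier, W' ≤ W → U.SubInv W' → W' = ⊥ ∨ W' = W

/-- `U` is a simple `A_{g,n}(V)`-module. -/
def IsSimple (U : AMod V g T l i) : Prop :=
  (∃ x : U.carrier, x ≠ 0) ∧ ∀ W : Submodule ℂ U.carrier, U.SubInv W → W = ⊥ ∨ W = ⊤

/-- `U` is a direct sum of simple `A_{g,n}(V)`-modules. -/
def CompletelyReducible (U : AMod V g T l i) : Prop :=
  ∃ (κ : Type) (S : κ → Submodule ℂ U.carrier),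
    (∀ j, U.SubInv (S j) ∧ U.SubSimple (S j)) ∧ iSupIndep S ∧ (⨆ j, S j) = ⊤

/-- All irreducible components of `U` do not factor through `A_{g,n-1/T}(V)`. -/
def GoodComponents (U : AMod V g T l i) : Prop :=
  ∀ W : Submodule ℂ U.carrier, U.SubInv W → U.SubSimple W →
    ∃ a ∈ Ogn V g T (predL l i) (predI T i), ∃ x ∈ W, U.rho a x ≠ 0

end AMod

/-- A morphism of `A_{g,n}(V)`-modules. -/
structure AModHom {V : VOA} {g : VOAAut V} {T l i : ℕ} (U U' : AMod V g T l i) where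
  toLin : U.carrier →ₗ[ℂ] U'.carrier
  comm : ∀ (a : V.carrier) (x : U.carrier), toLin (U.rho a x) = U'.rho a (toLin x)

namespace AModHom

variable {V : VOA} {g : VOAAut V} {T l i : ℕ}

def id (U : AMod V g T l i) : AModHom U U := ⟨LinearMap.id, fun _ _ => rfl⟩

def comp {U U' U'' : AMod V g T l i} (f' : AModHom U' U'') (f : AModHom U U') :
    AModHom U U'' :=
  ⟨f'.toLin.comp f.toLin, fun a x => by simp only [LinearMap.comp_apply, f.comm, f'.comm]⟩

end AModHom

end DLM
namespace DLM

/-! ### Generalized binomial coefficients -/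

theorem qchoose_zero (α : ℚ) : qchoose α 0 = 1 := by simp [qchoose]

theorem qchoose_succ (α : ℚ) (j : ℕ) :
    ((j : ℚ) + 1) * qchoose α (j + 1) = (α - j) * qchoose α j := by
  have h : (Nat.factorial j : ℚ) ≠ 0 := by positivity
  have h' : (j : ℚ) + 1 ≠ 0 := by positivity
  rw [qchoose, qchoose, Finset.prod_range_succ, Nat.factorial_succ]
  push_cast
  field_simp

theorem qchoose_succ_eq_mul_sub_one (α : ℚ) (j : ℕ) :
    ((j : ℚ) + 1) * qchoose α (j + 1) = α * qchoose (α - 1) j := by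
  have h : (Nat.factorial j : ℚ) ≠ 0 := by positivity
  have h' : (j : ℚ) + 1 ≠ 0 := by positivity
  rw [qchoose, qchoose, Finset.prod_range_succ', Nat.factorial_succ]
  have : ∀ k : ℕ, α - ((k + 1 : ℕ) : ℚ) = α - 1 - k := fun k => by push_cast; ring
  simp only [this]
  push_cast
  field_simp
  ring

theorem qchoose_eq_choose (α : ℚ) (j : ℕ) : qchoose α j = Ring.choose α j := by
  have h : ∀ j : ℕ, (descPochhammer ℤ j).smeval α = ∏ k ∈ Finset.range j, (α - k) := by
    intro j
    induction j with
    | zero => simp [Polynomial.smeval_one]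
    | succ j ih =>
      rw [descPochhammer_succ_right, Polynomial.smeval_mul, ih, Finset.prod_range_succ,
        Polynomial.smeval_sub, Polynomial.smeval_X, Polynomial.smeval_natCast]
      simp
  have h1 := Ring.descPochhammer_eq_factorial_smul_choose α j
  have h2 : (Nat.factorial j : ℚ) ≠ 0 := by positivity
  rw [h, nsmul_eq_mul] at h1
  rw [qchoose, h1]
  field_simp

theorem qchoose_natCast (n k : ℕ) : qchoose (n : ℚ) k = (n.choose k : ℚ) := by
  rw [qchoose_eq_choose, Ring.choose_natCast]

theorem qchoose_add (α β : ℚ) (n : ℕ) :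
    qchoose (α + β) n = ∑ k ∈ Finset.range (n + 1), qchoose α k * qchoose β (n - k) := by
  simp only [qchoose_eq_choose]
  rw [Ring.add_choose_eq n (Commute.all α β), Finset.Nat.sum_antidiagonal_eq_sum_range_succ_mk]

theorem neg_one_pow_mul_qchoose (α : ℚ) (n : ℕ) :
    (-1) ^ n * qchoose (α + n) n = qchoose (-α - 1) n := by
  have : ∀ n : ℕ, ∏ k ∈ Finset.range n, (-α - 1 - (k : ℚ)) =
      (-1) ^ n * ∏ k ∈ Finset.range n, (α + n - (k : ℚ)) := by
    intro n
    have h : (-1 : ℚ) ^ n = ∏ _k ∈ Finset.range n, (-1 : ℚ) := by simp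
    rw [← Finset.prod_range_reflect (fun k : ℕ => α + n - (k : ℚ)), h,
      ← Finset.prod_mul_distrib]
    refine Finset.prod_congr rfl fun k hk => ?_
    have hk := Finset.mem_range.1 hk
    rw [show n - 1 - k = n - (k + 1) by omega, Nat.cast_sub (by omega)]
    push_cast
    ring
  rw [qchoose, qchoose, this]
  ring

theorem qchoose_neg_one (n : ℕ) : qchoose (-1) n = (-1) ^ n := by
  have := neg_one_pow_mul_qchoose 0 n
  rw [zero_add, qchoose_natCast] at this
  simpa using this.symm

theorem qchoose_add_index (α : ℚ) (j i : ℕ) :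
    qchoose α (j + i) * ((j + i).choose j : ℚ) = qchoose α j * qchoose (α - j) i := by
  have h := Nat.add_choose_mul_factorial_mul_factorial j i
  have h1 : (((j + i).choose j : ℕ) : ℚ) * (j.factorial : ℚ) * (i.factorial : ℚ)
      = ((j + i).factorial : ℚ) := by
    rw [Nat.choose_symm_add]
    exact_mod_cast h
  have hj : (Nat.factorial j : ℚ) ≠ 0 := by positivity
  have hi : (Nat.factorial i : ℚ) ≠ 0 := by positivity
  have hij : (Nat.factorial (j + i) : ℚ) ≠ 0 := by positivity
  rw [qchoose, qchoose, qchoose, Finset.prod_range_add]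
  have : ∀ k : ℕ, α - ((j + k : ℕ) : ℚ) = α - j - k := fun k => by push_cast; ring
  simp only [this]
  field_simp
  rw [← h1]
  ring

theorem qchoose_ne_zero {α : ℚ} (h : ∀ n : ℕ, α ≠ n) (j : ℕ) : qchoose α j ≠ 0 := by
  rw [qchoose]
  refine div_ne_zero (Finset.prod_ne_zero_iff.2 fun k _ => sub_ne_zero.2 (h k)) (by positivity)

/-- Finitely many coefficients `π k` for which the recombination with the binomial coefficients
`binom(α, k + s)` vanishes for all large `s` are zero, provided `α` is not an integer. -/
theorem eq_zero_of_sum_qchoose_eq_zero {α : ℚ} (hα : ∀ n : ℤ, α ≠ n) (K : ℕ) :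
    ∀ (s₀ : ℕ) (π : ℕ → ℂ),
      (∀ s, s₀ ≤ s → ∑ k ∈ Finset.range K, ((qchoose α (k + s) : ℚ) : ℂ) * π k = 0) →
      ∀ k < K, π k = 0 := by
  have hαC : ∀ n : ℤ, (α : ℂ) ≠ n := fun n h => hα n (by exact_mod_cast h)
  have ratio : ∀ (s k : ℕ), ((∏ i ∈ Finset.range k, ((s : ℚ) + 1 + i)) * qchoose α (k + s)) =
      qchoose α s * ∏ i ∈ Finset.range k, (α - s - i) := by
    intro s k
    induction k with
    | zero => simp
    | succ k ih =>
      have h := qchoose_succ α (k + s)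
      rw [Finset.prod_range_succ, Finset.prod_range_succ, ← mul_assoc, ← ih,
        show k + 1 + s = k + s + 1 by ring]
      push_cast at h
      linear_combination (∏ i ∈ Finset.range k, ((s : ℚ) + 1 + i)) * h
  induction K with
  | zero => intro _ _ _ k hk; omega
  | succ K ih =>
    intro s₀ π h
    have h0 : π 0 = 0 := by
      let p : Polynomial ℂ := ∑ k ∈ Finset.range (K + 1), Polynomial.C (π k) *
        ((∏ i ∈ Finset.range k, (Polynomial.C (α : ℂ) - Polynomial.X - Polynomial.C (i : ℂ))) *
          ∏ i ∈ Finset.Ico k K, (Polynomial.X + 1 + Polynomial.C (i : ℂ)))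
      have hev : ∀ x : ℂ, p.eval x = ∑ k ∈ Finset.range (K + 1), π k *
          ((∏ i ∈ Finset.range k, ((α : ℂ) - x - (i : ℂ))) *
            ∏ i ∈ Finset.Ico k K, (x + 1 + (i : ℂ))) := by
        intro x
        simp [p, Polynomial.eval_finsetSum, Polynomial.eval_prod]
      have hp : p = 0 := by
        refine Polynomial.eq_zero_of_infinite_isRoot p ?_
        refine Set.Infinite.mono (s := (fun s : ℕ => ((s + s₀ : ℕ) : ℂ)) '' Set.univ) ?_ ?_
        · rintro _ ⟨s, -, rfl⟩
          set t := s + s₀ with ht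
          have hne : ((qchoose α t : ℚ) : ℂ) ≠ 0 := by
            exact_mod_cast qchoose_ne_zero (fun n => by exact_mod_cast hα n) t
          rw [Set.mem_ofPred_eq, Polynomial.IsRoot, hev]
          refine mul_left_cancel₀ hne ?_
          rw [mul_zero, ← mul_zero (∏ i ∈ Finset.range K, ((t : ℂ) + 1 + i)),
            ← h t (by omega), Finset.mul_sum, Finset.mul_sum]
          refine Finset.sum_congr rfl fun k hk => ?_
          have hk : k ≤ K := by have := Finset.mem_range.1 hk; omega
          have hr := ratio t k
          have hr' : ((∏ i ∈ Finset.range k, ((t : ℂ) + 1 + i)) * ((qchoose α (k + t) : ℚ) : ℂ)) =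
            ((qchoose α t : ℚ) : ℂ) * ∏ i ∈ Finset.range k, ((α : ℂ) - t - i) := by
            exact_mod_cast congrArg (fun q : ℚ => (q : ℂ)) hr
          have hs : (∏ i ∈ Finset.range k, ((t : ℂ) + 1 + i)) *
              ∏ i ∈ Finset.Ico k K, ((t : ℂ) + 1 + i) =
              ∏ i ∈ Finset.range K, ((t : ℂ) + 1 + i) := by
            exact Finset.prod_range_mul_prod_Ico _ hk
          rw [← hs]
          linear_combination (-π k * ∏ i ∈ Finset.Ico k K, ((t : ℂ) + 1 + i)) * hr'
        · refine Set.infinite_univ.image fun a _ b _ hab => ?_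
          have : a + s₀ = b + s₀ := by exact_mod_cast hab
          omega
      have h1 := hev α
      rw [hp, Polynomial.eval_zero, Finset.sum_range_succ', Finset.sum_eq_zero] at h1
      · simp only [Finset.range_zero, Finset.prod_empty, one_mul, zero_add] at h1
        refine (mul_eq_zero.1 h1.symm).resolve_right (Finset.prod_ne_zero_iff.2 fun i _ hi => ?_)
        refine hαC (-(i + 1 : ℤ)) ?_
        push_cast
        linear_combination hi
      · intro k _
        rw [Finset.prod_range_succ']
        simp
    intro k hk
    rcases k with _ | k
    · exact h0
    · refine ih (s₀ + 1) (fun k => π (k + 1)) (fun s hs => ?_) k (by omega)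
      have := h (s - 1) (by omega)
      rw [Finset.sum_range_succ', h0, mul_zero, add_zero] at this
      rw [← this]
      refine Finset.sum_congr rfl fun j _ => ?_
      rw [show j + 1 + (s - 1) = j + s by omega]

/-- The symmetric partial sums of the negative binomial series. -/
theorem sum_choose_mul_pow_symm {R : Type*} [CommRing R] (a b : R) (hab : a + b = 1) (l : ℕ) :
    ∑ m ∈ Finset.range (l + 1), ((m + l).choose l : R) *
      (a ^ (l + 1) * b ^ m + b ^ (l + 1) * a ^ m) = 1 := by
  have step : ∀ (a b : R), a + b = 1 → ∀ l : ℕ,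
      a ^ (l + 2) * ∑ m ∈ Finset.range (l + 2), ((m + (l + 1)).choose (l + 1) : R) * b ^ m =
        a ^ (l + 1) * ∑ m ∈ Finset.range (l + 1), ((m + l).choose l : R) * b ^ m +
        ((2 * l + 1).choose l : R) * (a ^ (l + 1) * b ^ (l + 1)) * (a - b) := by
    intro a b hab l
    have key : ∀ n : ℕ, (1 - b) *
        ∑ m ∈ Finset.range (n + 1), ((m + (l + 1)).choose (l + 1) : R) * b ^ m =
        ∑ m ∈ Finset.range (n + 1), ((m + l).choose l : R) * b ^ m -
          ((n + (l + 1)).choose (l + 1) : R) * b ^ (n + 1) := by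
      intro n
      induction n with
      | zero => simp
      | succ n ih =>
        rw [Finset.sum_range_succ (fun m => ((m + (l + 1)).choose (l + 1) : R) * b ^ m) (n + 1),
          mul_add, ih, Finset.sum_range_succ (fun m => ((m + l).choose l : R) * b ^ m) (n + 1)]
        have hc : ((n + 1 + (l + 1)).choose (l + 1) : R) =
            ((n + 1 + l).choose l : R) + ((n + (l + 1)).choose (l + 1) : R) := by
          rw [show n + 1 + (l + 1) = (n + 1 + l) + 1 by ring, Nat.choose_succ_succ,
            show n + (l + 1) = n + 1 + l by ring]
          push_cast
          ring
        rw [hc]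
        ring
    have h1 := key (l + 1)
    rw [Finset.sum_range_succ (fun m => ((m + l).choose l : R) * b ^ m) (l + 1)] at h1
    have hc : ((l + 1 + (l + 1)).choose (l + 1) : R) = 2 * ((2 * l + 1).choose l : R) := by
      rw [show l + 1 + (l + 1) = (2 * l + 1) + 1 by ring, Nat.choose_succ_succ,
        Nat.choose_symm_half]
      push_cast
      ring
    have ha : a = 1 - b := by linear_combination hab
    rw [show l + 1 + l = 2 * l + 1 by ring, hc] at h1
    rw [pow_succ a (l + 1), mul_assoc, ha]
    rw [h1]
    ring
  induction l with
  | zero => simpa using hab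
  | succ l ih =>
    have e : ∀ l : ℕ, ∑ m ∈ Finset.range (l + 1), ((m + l).choose l : R) *
      (a ^ (l + 1) * b ^ m + b ^ (l + 1) * a ^ m) =
        a ^ (l + 1) * ∑ m ∈ Finset.range (l + 1), ((m + l).choose l : R) * b ^ m +
        b ^ (l + 1) * ∑ m ∈ Finset.range (l + 1), ((m + l).choose l : R) * a ^ m := by
      intro l
      rw [Finset.mul_sum, Finset.mul_sum, ← Finset.sum_add_distrib]
      exact Finset.sum_congr rfl fun _ _ => by ring
    rw [e] at ih ⊢
    have s1 := step a b hab l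
    have s2 := step b a (by rw [add_comm]; exact hab) l
    linear_combination ih + s1 + s2

/-! ### Binomial powers of the shift operator on eventually vanishing sequences -/

section binShift

variable {W W₁ : Type*} [AddCommGroup W] [AddCommGroup W₁]

/-- The sequence `f` vanishes for all large indices. -/
def EvZero (f : ℤ → W) : Prop := ∃ K : ℤ, ∀ m, K ≤ m → f m = 0

theorem exists_binShift_bound {f : ℤ → W} (hf : EvZero f) (n : ℤ) :
    ∃ M : ℕ, ∀ m, n + M ≤ m → f m = 0 := by
  obtain ⟨K, hK⟩ := hf
  exact ⟨(K - n).toNat, fun m hm => hK m (by omega)⟩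

theorem EvZero.add {f h : ℤ → W} (hf : EvZero f) (hh : EvZero h) :
    EvZero fun m => f m + h m := by
  obtain ⟨K, hK⟩ := hf
  obtain ⟨K', hK'⟩ := hh
  exact ⟨max K K', fun m hm => by
    simp only [hK m ((le_max_left _ _).trans hm), hK' m ((le_max_right _ _).trans hm),
      add_zero]⟩

theorem EvZero.sum {ι : Type*} (s : Finset ι) {f : ι → ℤ → W} (hf : ∀ k ∈ s, EvZero (f k)) :
    EvZero fun m => ∑ k ∈ s, f k m := by
  classical
  induction s using Finset.induction_on with
  | empty => exact ⟨0, fun m _ => by simp⟩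
  | insert a s ha ih =>
    simp only [Finset.sum_insert ha]
    exact (hf a (Finset.mem_insert_self _ _)).add
      (ih fun k hk => hf k (Finset.mem_insert_of_mem hk))

variable [Module ℂ W] [Module ℂ W₁]

/-- `(1 + S)^α f`, where `S` is the shift `(S f) n = f (n + 1)`. -/
def binShift (α : ℚ) (f : ℤ → W) (n : ℤ) : W :=
  ∑ᶠ j : ℕ, ((qchoose α j : ℚ) : ℂ) • f (n + j)

theorem binShift_eq_sum (α : ℚ) {f : ℤ → W} {n : ℤ} {M : ℕ} (h : ∀ m, n + M ≤ m → f m = 0) :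
    binShift α f n = ∑ j ∈ Finset.range M, ((qchoose α j : ℚ) : ℂ) • f (n + j) := by
  refine finsum_eq_sum_of_support_subset _ fun j hj => ?_
  simp only [Finset.coe_range, Set.mem_Iio]
  by_contra hlt
  exact hj (by simp only [h _ (by omega : n + M ≤ n + (j : ℤ)), smul_zero])

theorem binShift_eq_zero (α : ℚ) {f : ℤ → W} {n : ℤ} (h : ∀ m, n ≤ m → f m = 0) :
    binShift α f n = 0 := by
  rw [binShift_eq_sum α (M := 0) (by simpa using h), Finset.sum_range_zero]

theorem EvZero.binShift {f : ℤ → W} (hf : EvZero f) (α : ℚ) : EvZero (binShift α f) := by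
  obtain ⟨K, hK⟩ := hf
  exact ⟨K, fun n hn => binShift_eq_zero α fun m hm => hK m (hn.trans hm)⟩

theorem binShift_natCast (N : ℕ) (f : ℤ → W) (n : ℤ) :
    binShift N f n = ∑ j ∈ Finset.range (N + 1), (N.choose j : ℂ) • f (n + j) := by
  rw [binShift, finsum_eq_sum_of_support_subset (s := Finset.range (N + 1))]
  · simp [qchoose_natCast]
  · intro j hj
    simp only [Finset.coe_range, Set.mem_Iio]
    by_contra hlt
    refine hj ?_
    beta_reduce
    rw [qchoose_natCast, Nat.choose_eq_zero_of_lt (by omega)]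
    simp

theorem binShift_zero (f : ℤ → W) (n : ℤ) : binShift 0 f n = f n := by
  simpa using binShift_natCast 0 f n

theorem binShift_one (f : ℤ → W) (n : ℤ) : binShift 1 f n = f n + f (n + 1) := by
  simpa [Finset.sum_range_succ] using binShift_natCast 1 f n

theorem binShift_add (α γ : ℚ) {f : ℤ → W} (hf : EvZero f) (n : ℤ) :
    binShift (α + γ) f n = binShift α (binShift γ f) n := by
  obtain ⟨M, hM⟩ := exists_binShift_bound hf n
  have h2 : ∀ m, n + M ≤ m → binShift γ f m = 0 := fun m hm =>
    binShift_eq_zero γ fun m' hm' => hM _ (hm.trans hm')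
  have h3 : ∀ j ∈ Finset.range M, ((qchoose α j : ℚ) : ℂ) • binShift γ f (n + j) =
      ∑ i ∈ Finset.range (M - j),
        (((qchoose α j : ℚ) : ℂ) * ((qchoose γ i : ℚ) : ℂ)) • f (n + ((j + i : ℕ) : ℤ)) := by
    intro j hj
    have hj := Finset.mem_range.1 hj
    rw [binShift_eq_sum γ (M := M - j) (fun m hm => hM m (by omega)), Finset.smul_sum]
    refine Finset.sum_congr rfl fun i _ => ?_
    rw [smul_smul, Nat.cast_add, add_assoc]
  rw [binShift_eq_sum _ hM, binShift_eq_sum _ h2, Finset.sum_congr rfl h3,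
    ← Finset.sum_range_diag_flip M fun j i => (((qchoose α j : ℚ) : ℂ) *
      ((qchoose γ i : ℚ) : ℂ)) • f (n + ((j + i : ℕ) : ℤ))]
  refine Finset.sum_congr rfl fun N _ => ?_
  rw [qchoose_add]
  push_cast
  rw [Finset.sum_smul]
  refine Finset.sum_congr rfl fun j hj => ?_
  have hj := Finset.mem_range.1 hj
  rw [Nat.cast_sub (by omega : j ≤ N), add_sub_cancel]

theorem sum_neg_one_pow_mul_qchoose (α γ : ℚ) (N : ℕ) :
    ∑ j ∈ Finset.range (N + 1), (-1) ^ j * qchoose α j * qchoose (γ - j) (N - j) =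
      qchoose (γ - α) N := by
  have h1 : ∀ j ∈ Finset.range (N + 1), (-1) ^ j * qchoose α j * qchoose (γ - j) (N - j) =
      (-1) ^ N * (qchoose α j * qchoose (N - γ - 1) (N - j)) := by
    intro j hj
    have hj : j ≤ N := by have := Finset.mem_range.1 hj; omega
    have h := neg_one_pow_mul_qchoose (γ - N) (N - j)
    rw [show γ - N + ((N - j : ℕ) : ℚ) = γ - j by rw [Nat.cast_sub hj]; ring,
      show -(γ - N) - 1 = N - γ - 1 by ring] at h
    rw [← h]
    have e : (-1 : ℚ) ^ N = (-1) ^ j * (-1) ^ (N - j) := by rw [← pow_add]; congr 1; omega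
    have e2 : (-1 : ℚ) ^ (N - j) * (-1) ^ (N - j) = 1 := by rw [← mul_pow]; simp
    rw [e]
    linear_combination (-(-1) ^ j * qchoose α j * qchoose (γ - j) (N - j)) * e2
  rw [Finset.sum_congr rfl h1, ← Finset.mul_sum, ← qchoose_add]
  have h := neg_one_pow_mul_qchoose (α + (N - γ - 1) - N) N
  rw [sub_add_cancel] at h
  rw [h]
  congr 1
  ring

/-- The substitution `(1 - S / (1 + S))^α = (1 + S)^{-α}`. -/
theorem binShift_sub (α γ : ℚ) {f : ℤ → W} {n : ℤ} {M : ℕ} (hM : ∀ m, n + M ≤ m → f m = 0) :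
    ∑ j ∈ Finset.range M,
      ((-1 : ℂ) ^ j * ((qchoose α j : ℚ) : ℂ)) • binShift (γ - j) f (n + j) =
      binShift (γ - α) f n := by
  have h3 : ∀ j ∈ Finset.range M,
      ((-1 : ℂ) ^ j * ((qchoose α j : ℚ) : ℂ)) • binShift (γ - j) f (n + j) =
      ∑ i ∈ Finset.range (M - j), ((-1 : ℂ) ^ j * ((qchoose α j : ℚ) : ℂ) *
        ((qchoose (γ - j) i : ℚ) : ℂ)) • f (n + ((j + i : ℕ) : ℤ)) := by
    intro j hj
    have hj := Finset.mem_range.1 hj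
    rw [binShift_eq_sum _ (M := M - j) (fun m hm => hM m (by omega)), Finset.smul_sum]
    refine Finset.sum_congr rfl fun i _ => ?_
    rw [smul_smul, Nat.cast_add, add_assoc]
  rw [binShift_eq_sum _ hM, Finset.sum_congr rfl h3,
    ← Finset.sum_range_diag_flip M fun j i => ((-1 : ℂ) ^ j * ((qchoose α j : ℚ) : ℂ) *
      ((qchoose (γ - j) i : ℚ) : ℂ)) • f (n + ((j + i : ℕ) : ℤ))]
  refine Finset.sum_congr rfl fun N _ => ?_
  rw [← sum_neg_one_pow_mul_qchoose]
  push_cast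
  rw [Finset.sum_smul]
  refine Finset.sum_congr rfl fun j hj => ?_
  have hj := Finset.mem_range.1 hj
  rw [Nat.cast_sub (by omega : j ≤ N), add_sub_cancel]

theorem EvZero.smul {f : ℤ → W} (hf : EvZero f) (c : ℂ) : EvZero fun m => c • f m := by
  obtain ⟨K, hK⟩ := hf
  exact ⟨K, fun m hm => by simp only [hK m hm, smul_zero]⟩

theorem binShift_fun_add (α : ℚ) {f h : ℤ → W} (hf : EvZero f) (hh : EvZero h) (n : ℤ) :
    binShift α (fun m => f m + h m) n = binShift α f n + binShift α h n := by
  obtain ⟨M, hM⟩ := exists_binShift_bound hf n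
  obtain ⟨M', hM'⟩ := exists_binShift_bound hh n
  rw [binShift_eq_sum α (M := max M M') (fun m hm => hM m (by push_cast at hm; omega)),
    binShift_eq_sum α (M := max M M') (fun m hm => hM' m (by push_cast at hm; omega)),
    binShift_eq_sum α (M := max M M') (fun m hm => by
      rw [hM m (by push_cast at hm; omega), hM' m (by push_cast at hm; omega), add_zero]),
    ← Finset.sum_add_distrib]
  exact Finset.sum_congr rfl fun j _ => smul_add _ _ _

theorem map_binShift (α : ℚ) (φ : W →ₗ[ℂ] W₁) {f : ℤ → W} (hf : EvZero f) (n : ℤ) :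
    φ (binShift α f n) = binShift α (fun m => φ (f m)) n := by
  obtain ⟨M, hM⟩ := exists_binShift_bound hf n
  rw [binShift_eq_sum α hM, binShift_eq_sum α (fun m hm => by rw [hM m hm, map_zero]), map_sum]
  exact Finset.sum_congr rfl fun j _ => map_smul _ _ _

theorem binShift_fun_smul (α : ℚ) (c : ℂ) {f : ℤ → W} (hf : EvZero f) (n : ℤ) :
    binShift α (fun m => c • f m) n = c • binShift α f n :=
  (map_binShift α (c • LinearMap.id (R := ℂ) (M := W)) hf n).symm

theorem binShift_fun_sum {ι : Type*} (α : ℚ) (s : Finset ι) {f : ι → ℤ → W}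
    (hf : ∀ k ∈ s, EvZero (f k)) (n : ℤ) :
    binShift α (fun m => ∑ k ∈ s, f k m) n = ∑ k ∈ s, binShift α (f k) n := by
  classical
  induction s using Finset.induction_on with
  | empty => simpa using binShift_eq_zero α (f := fun _ => (0 : W)) (n := n) (fun _ _ => rfl)
  | insert a s ha ih =>
    simp only [Finset.sum_insert ha]
    have hs : ∀ k ∈ s, EvZero (f k) := fun k hk => hf k (Finset.mem_insert_of_mem hk)
    rw [binShift_fun_add α (hf a (Finset.mem_insert_self _ _)) (EvZero.sum s hs), ih hs]

theorem binShift_mem (α : ℚ) (O : Submodule ℂ W) {f : ℤ → W} (hf : EvZero f) {n : ℤ}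
    (h : ∀ m, n ≤ m → f m ∈ O) : binShift α f n ∈ O := by
  obtain ⟨M, hM⟩ := exists_binShift_bound hf n
  rw [binShift_eq_sum α hM]
  exact O.sum_mem fun j _ => O.smul_mem _ (h _ (by omega))

/-- If `(1 + S)^α f` lies in `O` at all sufficiently negative indices, where `α` is not an
integer and `f` vanishes at large and lies in `O` at small indices, then `f` lies in `O`. -/
theorem mem_of_binShift_mem {α : ℚ} (hα : ∀ n : ℤ, α ≠ n) (O : Submodule ℂ W) {f : ℤ → W}
    (hf : EvZero f) {A B : ℤ} (hlow : ∀ m ≤ A, f m ∈ O) (h : ∀ m ≤ B, binShift α f m ∈ O)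
    (m : ℤ) : f m ∈ O := by
  rcases le_or_gt m A with hm | hm
  · exact hlow m hm
  obtain ⟨K, hK⟩ := exists_binShift_bound hf (A + 1)
  rcases le_or_gt (A + 1 + K) m with hm' | hm'
  · rw [hK m hm']
    exact O.zero_mem
  rw [← Submodule.Quotient.mk_eq_zero, ← Module.forall_dual_apply_eq_zero_iff ℂ]
  intro ψ
  have key := eq_zero_of_sum_qchoose_eq_zero hα K (A + 1 - B).toNat
    (fun k => ψ (Submodule.Quotient.mk (f (A + 1 + k)))) ?_ (m - (A + 1)).toNat (by omega)
  · rw [← key]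
    congr 3
    omega
  · intro s hs
    have h1 := h (A + 1 - s) (by omega)
    rw [binShift_eq_sum α (M := s + K) (fun m hm => hK m (by push_cast at hm; omega)),
      Finset.sum_range_add] at h1
    have h2 := (Submodule.add_mem_iff_right _ (O.sum_mem fun j hj => O.smul_mem _
      (hlow _ (by have := Finset.mem_range.1 hj; omega)))).1 h1
    have h3 := congrArg ψ ((Submodule.Quotient.mk_eq_zero O).2 h2)
    rw [map_zero, ← Submodule.mkQ_apply, map_sum, map_sum] at h3
    rw [← h3]
    refine Finset.sum_congr rfl fun k _ => ?_
    rw [map_smul, map_smul, smul_eq_mul, Submodule.mkQ_apply, add_comm k s]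
    congr 4
    push_cast
    ring

end binShift

/-! ### Modes of a vertex operator algebra -/

theorem qchoose_zero_succ (j : ℕ) : qchoose 0 (j + 1) = 0 := by
  simpa using qchoose_natCast 0 (j + 1)

section VOA

variable (V : VOA)

theorem evZero_mode (u v : V.carrier) : EvZero fun m => V.mode u m v := V.trunc u v

theorem res_eq_binShift (α : ℚ) (β : ℤ) (u v : V.carrier) :
    V.res α β u v = binShift α (fun m => V.mode u m v) (-β) := by
  simp only [VOA.res, binShift, sub_eq_neg_add]

theorem mode_commutator (u v w : V.carrier) (p q : ℤ) {M : ℕ}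
    (hM : ∀ m : ℤ, M ≤ m → V.mode u m v = 0) :
    V.mode u p (V.mode v q w) - V.mode v q (V.mode u p w) =
      ∑ j ∈ Finset.range M, ((qchoose p j : ℚ) : ℂ) • V.mode (V.mode u j v) (p + q - j) w := by
  have h := V.borcherds u v w p q 0
  rw [finsum_eq_sum_of_support_subset (s := Finset.range M), finsum_eq_single _ 0] at h
  · simpa [qchoose_zero] using h.symm
  · intro j hj
    obtain ⟨j, rfl⟩ := Nat.exists_eq_succ_of_ne_zero hj
    simp [qchoose_zero_succ]
  · intro j hj
    simp only [Finset.coe_range, Set.mem_Iio]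
    by_contra hlt
    exact hj (by simp [hM j (by omega)])

theorem lneg1_commutator (b w : V.carrier) (m : ℤ) :
    V.mode V.conformal 0 (V.mode b m w) - V.mode b m (V.mode V.conformal 0 w) =
      -(m : ℂ) • V.mode b (m - 1) w := by
  obtain ⟨K, hK⟩ := V.trunc V.conformal b
  have h := mode_commutator V V.conformal b w 0 m (M := K.toNat + 1) fun n hn => hK n (by omega)
  rw [Finset.sum_eq_single 0] at h
  · have hL := congrArg (fun φ => φ w) (V.Lneg1_mode b m)
    simpa [qchoose_zero] using h.trans (by simpa [qchoose_zero] using hL)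
  · intro j _ hj
    obtain ⟨j, rfl⟩ := Nat.exists_eq_succ_of_ne_zero hj
    simp [qchoose_zero_succ]
  · simp

theorem lneg1_mem_wtSpace {k : ℤ} {a : V.carrier} (ha : a ∈ V.wtSpace k) :
    V.mode V.conformal 0 a ∈ V.wtSpace (k + 1) := by
  have := V.mode_grading 2 k 0 _ _ V.conformal_wt ha
  rwa [show (2 : ℤ) + k - 0 - 1 = k + 1 by ring] at this

theorem mode_skew_symm (u v : V.carrier) (s : ℤ) {M : ℕ}
    (hM : ∀ m : ℤ, s + M ≤ m → V.mode u m v = 0) :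
    V.mode v s u = (-1 : ℂ) ^ (s + 1) • ∑ j ∈ Finset.range M,
      (-1 : ℂ) ^ j • V.mode (V.mode u (s + j) v) (-1 - j) V.vacuum := by
  have h := V.borcherds u v V.vacuum (-1) 0 s
  rw [finsum_eq_sum_of_support_subset (s := Finset.range M), finsum_eq_single _ 0] at h
  · have e : (-1 : ℂ) ^ (s + 1) = -(-1 : ℂ) ^ s := by rw [zpow_add₀ (by norm_num)]; simp
    have e2 : (-1 : ℂ) ^ s * (-1 : ℂ) ^ s = 1 := by rw [← mul_zpow]; simp
    have hs : ∑ j ∈ Finset.range M,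
        (-1 : ℂ) ^ j • V.mode (V.mode u (s + j) v) (-1 - j) V.vacuum =
        -((-1 : ℂ) ^ s • V.mode v s u) := by
      simpa [qchoose_neg_one, qchoose_zero, V.creation₁, V.creation₂] using h
    rw [hs, e, neg_smul_neg, smul_smul, e2, one_smul]
  · intro j hj
    rw [V.creation₂ v _ (by omega), V.creation₂ u _ (by omega)]
    simp
  · intro j hj
    simp only [Finset.coe_range, Set.mem_Iio]
    by_contra hlt
    exact hj (by simp [hM (s + j) (by omega)])

end VOA

/-! ### Congruences modulo `O_{g,n}(V)` -/

section Ogn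

variable (V : VOA) (g : VOAAut V) (T l i : ℕ)

theorem lneg1_add_mem {k : ℤ} {a : V.carrier} (ha : a ∈ V.wtSpace k) :
    V.mode V.conformal 0 a + (k : ℂ) • a ∈ Ogn V g T l i := by
  rw [← V.L0_grading k a ha]
  exact Submodule.subset_span (Or.inl ⟨a, rfl⟩)

theorem mode_vacuum_sub_mem (j : ℕ) : ∀ {k : ℤ} {a : V.carrier}, a ∈ V.wtSpace k →
    V.mode a (-1 - j) V.vacuum - ((qchoose (-k) j : ℚ) : ℂ) • a ∈ Ogn V g T l i := by
  induction j with
  | zero =>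
    intro k a _
    simp [V.creation₁, qchoose_zero]
  | succ j ih =>
    intro k a ha
    have h1 := ih (lneg1_mem_wtSpace V ha)
    have h2 := lneg1_add_mem V g T l i ha
    have h3 := congrArg (fun φ => φ V.vacuum) (V.Lneg1_mode a (-1 - j))
    have hj : (j : ℂ) + 1 ≠ 0 := by exact_mod_cast Nat.succ_ne_zero j
    have hq : ((j : ℂ) + 1) * ((qchoose (-k) (j + 1) : ℚ) : ℂ) =
        -(k : ℂ) * ((qchoose (-((k + 1 : ℤ) : ℚ)) j : ℚ) : ℂ) := by
      have := congrArg (fun q : ℚ => (q : ℂ)) (qchoose_succ_eq_mul_sub_one (-k) j)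
      push_cast at this ⊢
      rw [this]
      congr 3
      ring_nf
    refine (Submodule.smul_mem_iff _ hj).1 ?_
    have : ((j : ℂ) + 1) • (V.mode a (-1 - (j + 1 : ℕ)) V.vacuum -
        ((qchoose (-k) (j + 1) : ℚ) : ℂ) • a) =
        (V.mode (V.mode V.conformal 0 a) (-1 - j) V.vacuum -
          ((qchoose (-((k + 1 : ℤ) : ℚ)) j : ℚ) : ℂ) • V.mode V.conformal 0 a) +
        ((qchoose (-((k + 1 : ℤ) : ℚ)) j : ℚ) : ℂ) •
          (V.mode V.conformal 0 a + (k : ℂ) • a) := by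
      rw [smul_sub, smul_smul, hq]
      simp only [LinearMap.smul_apply] at h3
      rw [h3, show (-1 - ((j + 1 : ℕ) : ℤ)) = -1 - (j : ℤ) - 1 by push_cast; ring]
      push_cast
      module
    rw [this]
    exact add_mem h1 (Submodule.smul_mem _ _ h2)

theorem mode_swap_mem {a b : ℤ} {u v : V.carrier} (hu : u ∈ V.wtSpace a) (hv : v ∈ V.wtSpace b)
    (s : ℤ) :
    V.mode v s u - (-1 : ℂ) ^ (s + 1) • binShift (a + b - 2 - s) (fun m => V.mode u m v) s ∈
      Ogn V g T l i := by
  obtain ⟨M, hM⟩ := exists_binShift_bound (evZero_mode V u v) s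
  rw [binShift_eq_sum _ hM, mode_skew_symm V u v s hM, ← smul_sub, ← Finset.sum_sub_distrib]
  refine Submodule.smul_mem _ _ (Submodule.sum_mem _ fun j _ => ?_)
  have h := mode_vacuum_sub_mem V g T l i j (V.mode_grading a b (s + j) u v hu hv)
  have hq := neg_one_pow_mul_qchoose (a + b - 2 - s - j) j
  rw [sub_add_cancel, show -((a : ℚ) + b - 2 - s - j) - 1 =
    -((a + b - (s + j) - 1 : ℤ) : ℚ) by push_cast; ring] at hq
  rw [← hq] at h
  have e2 : (-1 : ℂ) ^ j * (-1 : ℂ) ^ j = 1 := by rw [← mul_pow]; simp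
  have := Submodule.smul_mem _ ((-1 : ℂ) ^ j) h
  rw [smul_sub, smul_smul] at this
  push_cast at this
  rw [← mul_assoc, e2, one_mul] at this
  exact this

theorem binShift_swap_mem {a b : ℤ} {u v : V.carrier} (hu : u ∈ V.wtSpace a)
    (hv : v ∈ V.wtSpace b) (α : ℚ) (n : ℤ) :
    binShift α (fun m => V.mode v m u) n -
      (-1 : ℂ) ^ (n + 1) • binShift (a + b - 2 - n - α) (fun m => V.mode u m v) n ∈
      Ogn V g T l i := by
  obtain ⟨M, hM⟩ := exists_binShift_bound (evZero_mode V u v) n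
  obtain ⟨M', hM'⟩ := exists_binShift_bound (evZero_mode V v u) n
  rw [← binShift_sub α _ (M := max M M') (fun m hm => hM m (by push_cast at hm; omega)),
    binShift_eq_sum _ (M := max M M') (fun m hm => hM' m (by push_cast at hm; omega)),
    Finset.smul_sum, ← Finset.sum_sub_distrib]
  refine Submodule.sum_mem _ fun j _ => ?_
  have h := Submodule.smul_mem _ ((qchoose α j : ℚ) : ℂ) (mode_swap_mem V g T l i hu hv (n + j))
  have e : (-1 : ℂ) ^ (n + j + 1) = (-1 : ℂ) ^ (n + 1) * (-1 : ℂ) ^ j := by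
    rw [show n + (j : ℤ) + 1 = n + 1 + j by ring, zpow_add₀ (by norm_num), zpow_natCast]
  rw [smul_sub, e] at h
  convert h using 2
  rw [smul_smul, smul_smul, show (a : ℚ) + b - 2 - ((n + j : ℤ) : ℚ) = a + b - 2 - n - j by
    push_cast; ring]
  congr 1
  ring

end Ogn

/-! ### Commuting with the fixed point subalgebra -/

theorem sum_choose_mul_pow_symm_homogeneous {K : Type*} [Field K] (a b c : K) (hab : a + b = c)
    (hc : c ≠ 0) (l : ℕ) :
    ∑ m ∈ Finset.range (l + 1), ((m + l).choose l : K) *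
      (a ^ (l + 1) * b ^ m + b ^ (l + 1) * a ^ m) * c ^ (l - m) = c ^ (2 * l + 1) := by
  have h := sum_choose_mul_pow_symm (a / c) (b / c) (by rw [← add_div, hab, div_self hc]) l
  rw [← one_mul (c ^ (2 * l + 1)), ← h, Finset.sum_mul]
  refine Finset.sum_congr rfl fun m hm => ?_
  have hm : m ≤ l := by have := Finset.mem_range.1 hm; omega
  have e : c ^ (2 * l + 1) = c ^ (l + 1) * c ^ m * c ^ (l - m) := by
    rw [← pow_add, ← pow_add]; congr 1; omega
  rw [e, div_pow, div_pow, div_pow, div_pow]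
  field_simp

theorem sum_choose_mul_one_add_X (l : ℕ) :
    ∑ m ∈ Finset.range (l + 1), Polynomial.C ((m + l).choose l : ℂ) *
      (Polynomial.C ((-1) ^ m) * (1 + Polynomial.X) ^ (l + 2) -
        Polynomial.C ((-1) ^ l) * (1 + Polynomial.X) ^ (m + 1)) * Polynomial.X ^ (l - m) =
      (1 + Polynomial.X) * Polynomial.X ^ (2 * l + 1) := by
  apply RatFunc.algebraMap_injective ℂ
  have hX : (RatFunc.X : RatFunc ℂ) ≠ 0 := RatFunc.X_ne_zero
  have h := sum_choose_mul_pow_symm_homogeneous (1 + RatFunc.X : RatFunc ℂ) (-1) RatFunc.X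
    (by ring) hX l
  simp only [map_sum, map_mul, map_sub, map_pow, map_add, map_one, RatFunc.algebraMap_X, map_neg,
    map_natCast]
  rw [← h, Finset.mul_sum]
  refine Finset.sum_congr rfl fun m _ => ?_
  ring

section

variable {W : Type*} [AddCommGroup W] [Module ℂ W]

/-- Evaluation of the sequence `f`, started at `n`, on a polynomial in the shift operator. -/
def evalSeq (f : ℤ → W) (n : ℤ) : Polynomial ℂ →ₗ[ℂ] W :=
  Polynomial.lsum fun j => LinearMap.toSpanSingleton ℂ W (f (n + j))

theorem evalSeq_C_mul_pow (f : ℤ → W) (n : ℤ) (c : ℂ) (N s : ℕ) :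
    evalSeq f n (Polynomial.C c * (1 + Polynomial.X) ^ N * Polynomial.X ^ s) =
      c • binShift N f (n + s) := by
  have h : Polynomial.C c * (1 + Polynomial.X) ^ N * Polynomial.X ^ s =
      ∑ j ∈ Finset.range (N + 1), Polynomial.monomial (s + j) (c * (N.choose j : ℂ)) := by
    rw [add_comm, add_pow, Finset.mul_sum, Finset.sum_mul]
    refine Finset.sum_congr rfl fun j _ => ?_
    rw [← Polynomial.C_mul_X_pow_eq_monomial, pow_add]
    simp only [one_pow, mul_one, map_mul, map_natCast]
    ring
  rw [h, map_sum, binShift_natCast, Finset.smul_sum]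
  refine Finset.sum_congr rfl fun j _ => ?_
  simp [evalSeq, Polynomial.lsum_apply, Polynomial.sum_monomial_index, smul_smul, add_assoc]

theorem sum_choose_smul_binShift (f : ℤ → W) (l : ℕ) :
    ∑ m ∈ Finset.range (l + 1), ((m + l).choose l : ℂ) •
      ((-1 : ℂ) ^ m • binShift ((l + 2 : ℕ) : ℚ) f (-(l + m + 1)) -
        (-1 : ℂ) ^ l • binShift ((m + 1 : ℕ) : ℚ) f (-(l + m + 1))) = f 0 + f 1 := by
  have h := congrArg (evalSeq f (-(2 * l + 1))) (sum_choose_mul_one_add_X l)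
  have hr := evalSeq_C_mul_pow f (-(2 * l + 1)) 1 1 (2 * l + 1)
  rw [map_one, one_mul, pow_one] at hr
  rw [hr, one_smul, Nat.cast_one, binShift_one, map_sum] at h
  have e : (-(2 * l + 1) + ((2 * l + 1 : ℕ) : ℤ)) = 0 := by push_cast; ring
  rw [e, zero_add] at h
  rw [← h]
  refine Finset.sum_congr rfl fun m hm => ?_
  have hm : m ≤ l := by have := Finset.mem_range.1 hm; omega
  have e1 : (-(l + m + 1) : ℤ) = -(2 * l + 1) + ((l - m : ℕ) : ℤ) := by
    rw [Nat.cast_sub hm]; ring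
  rw [e1, smul_sub, smul_smul, smul_smul, ← evalSeq_C_mul_pow, ← evalSeq_C_mul_pow, ← map_sub]
  congr 1
  simp only [map_mul]
  ring

end

theorem starFor_comm_mem (V : VOA) (g : VOAAut V) (T l i : ℕ) {k : ℤ} {v : V.carrier}
    (hv : v ∈ V.wtSpace k) :
    starFor V l 2 V.conformal v - starFor V l k v V.conformal ∈ Ogn V g T l i := by
  have hA : V.mode V.conformal 0 v + V.mode V.conformal 1 v ∈ Ogn V g T l i :=
    Submodule.subset_span (Or.inl ⟨v, rfl⟩)
  rw [← sum_choose_smul_binShift (fun m => V.mode V.conformal m v) l] at hA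
  rw [← Submodule.sub_mem_iff_left _ hA, starFor, starFor, ← Finset.sum_sub_distrib,
    ← Finset.sum_sub_distrib]
  refine Submodule.sum_mem _ fun m hm => ?_
  have h := binShift_swap_mem V g T l i V.conformal_wt hv (k + l) (-(l + m + 1))
  have e1 : (((2 : ℤ) : ℚ) + k - 2 - ((-(l + m + 1) : ℤ) : ℚ) - (k + l)) = ((m + 1 : ℕ) : ℚ) := by
    push_cast; ring
  have e2 : (-1 : ℂ) ^ (-((l : ℤ) + m + 1) + 1) = (-1) ^ l * (-1) ^ m := by
    rw [show -((l : ℤ) + m + 1) + 1 = -((l + m : ℕ) : ℤ) by push_cast; ring, zpow_neg,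
      zpow_natCast, ← inv_pow, ← pow_add]
    norm_num
  have e3 : (-1 : ℂ) ^ m * (-1 : ℂ) ^ m = 1 := by rw [← mul_pow]; simp
  rw [e1, e2] at h
  have h2 := Submodule.smul_mem _ (-((-1 : ℂ) ^ m * ((m + l).choose l : ℂ))) h
  convert h2 using 1
  rw [res_eq_binShift, res_eq_binShift, show ((2 : ℤ) : ℚ) + l = ((l + 2 : ℕ) : ℚ) by
    push_cast; ring]
  simp only [smul_sub, smul_smul]
  have e4 : -((-1 : ℂ) ^ m * ((m + l).choose l : ℂ)) * ((-1) ^ l * (-1) ^ m) =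
      -(((m + l).choose l : ℂ) * (-1) ^ l) := by
    linear_combination (-((m + l).choose l : ℂ) * (-1) ^ l) * e3
  rw [e4]
  module

/-! ### Locality and ideals -/

section binShift

variable {W : Type*} [AddCommGroup W] [Module ℂ W]

theorem binShift_neg_mul_pred (α : ℚ) {f : ℤ → W} (hf : EvZero f) (n : ℤ) :
    binShift α (fun m => -(m : ℂ) • f (m - 1)) n =
      -(n : ℂ) • binShift α f (n - 1) - (α : ℂ) • binShift (α - 1) f n := by
  obtain ⟨M, hM⟩ := exists_binShift_bound hf (n - 1)
  have h1 : ∀ m, n + (M + 1 : ℕ) ≤ m → -(m : ℂ) • f (m - 1) = 0 := fun m hm => by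
    rw [hM _ (by push_cast at hm; omega), smul_zero]
  rw [binShift_eq_sum α h1,
    binShift_eq_sum α (M := M + 1) (fun m hm => hM m (by push_cast at hm; omega)),
    binShift_eq_sum (α - 1) (M := M) (fun m hm => hM m (by omega)), Finset.smul_sum,
    Finset.smul_sum, Finset.sum_range_succ', Finset.sum_range_succ',
    add_sub_right_comm (Finset.sum _ _),
    ← Finset.sum_sub_distrib]
  congr 1
  · refine Finset.sum_congr rfl fun j _ => ?_
    have h := congrArg (fun q : ℚ => (q : ℂ)) (qchoose_succ_eq_mul_sub_one α j)
    push_cast at h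
    rw [show n + ((j + 1 : ℕ) : ℤ) - 1 = n + j by push_cast; ring,
      show n - 1 + ((j + 1 : ℕ) : ℤ) = n + j by push_cast; ring, smul_smul, smul_smul,
      smul_smul, ← sub_smul, ← h]
    congr 1
    push_cast
    ring
  · simp [qchoose_zero]

theorem binShift_choose_smul (α : ℚ) (j : ℕ) {f : ℤ → W} (hf : EvZero f) (m : ℤ) :
    binShift α (fun p => ((qchoose (p : ℚ) j : ℚ) : ℂ) • f (p + m - j)) 0 =
      ((qchoose α j : ℚ) : ℂ) • binShift (α - j) f m := by
  obtain ⟨M, hM⟩ := exists_binShift_bound hf m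
  rw [binShift_eq_sum (α - j) hM, binShift_eq_sum α (M := j + M) (fun p hp => by
    rw [hM _ (by push_cast at hp; omega), smul_zero]), Finset.sum_range_add,
    Finset.sum_eq_zero, zero_add, Finset.smul_sum]
  · refine Finset.sum_congr rfl fun i _ => ?_
    rw [smul_smul, smul_smul, ← Rat.cast_mul, ← Rat.cast_mul, zero_add, Int.cast_natCast,
      qchoose_natCast, qchoose_add_index]
    congr 2
    push_cast
    ring
  · intro p hp
    have hp := Finset.mem_range.1 hp
    rw [zero_add, Int.cast_natCast, qchoose_natCast, Nat.choose_eq_zero_of_lt hp]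
    simp

end binShift

section ideal

variable (V : VOA)

/-- The operators `X m` are local of order `N` with respect to the modes of `u`. -/
def IsLocalWith (u : V.carrier) (N : ℕ) (X : ℤ → V.carrier → V.carrier) : Prop :=
  ∀ (p m : ℤ) (w : V.carrier), ∑ j ∈ Finset.range (N + 1), ((-1 : ℂ) ^ j * (N.choose j : ℂ)) •
    (V.mode u (p + N - j) (X (m + j) w) -
      (-1 : ℂ) ^ N • X (m + N - j) (V.mode u (p + j) w)) = 0

theorem isLocalWith_mode (u b : V.carrier) {N : ℕ} (hN : ∀ m : ℤ, N ≤ m → V.mode u m b = 0) :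
    IsLocalWith V u N fun m w => V.mode b m w := by
  intro p m w
  have h := V.borcherds u b w p m N
  rw [finsum_eq_zero_of_forall_eq_zero (fun j => by simp [hN (N + j) (by omega)]),
    finsum_eq_sum_of_support_subset (s := Finset.range (N + 1))] at h
  · simpa [qchoose_natCast] using h.symm
  · intro j hj
    simp only [Finset.coe_range, Set.mem_Iio]
    by_contra hlt
    exact hj (by simp [qchoose_natCast, Nat.choose_eq_zero_of_lt (by omega : N < j)])

variable {V}

theorem IsLocalWith.sum {ι : Type*} (s : Finset ι) {u : V.carrier} {N : ℕ}
    {X : ι → ℤ → V.carrier → V.carrier} (hX : ∀ k ∈ s, IsLocalWith V u N (X k)) (c : ι → ℂ)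
    (d : ι → ℤ) : IsLocalWith V u N fun m w => ∑ k ∈ s, c k • X k (m + d k) w := by
  intro p m w
  have h : ∀ k ∈ s, c k • ∑ j ∈ Finset.range (N + 1), ((-1 : ℂ) ^ j * (N.choose j : ℂ)) •
      (V.mode u (p + N - j) (X k (m + d k + j) w) -
        (-1 : ℂ) ^ N • X k (m + d k + N - j) (V.mode u (p + j) w)) = 0 := fun k hk => by
    rw [hX k hk p (m + d k) w, smul_zero]
  rw [← Finset.sum_eq_zero h]
  simp only [Finset.smul_sum]
  rw [Finset.sum_comm]
  refine Finset.sum_congr rfl fun j _ => ?_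
  simp only [map_sum, map_smul, Finset.smul_sum, smul_sub, Finset.sum_sub_distrib]
  congr 1
  · refine Finset.sum_congr rfl fun k _ => ?_
    rw [smul_comm, add_right_comm]
  · refine Finset.sum_congr rfl fun k _ => ?_
    rw [smul_comm (c k), smul_comm (c k), show m + N - j + d k = m + d k + N - j by ring]

theorem IsLocalWith.binShift {u : V.carrier} {N : ℕ} {X : ℤ → V.carrier → V.carrier}
    (hX : IsLocalWith V u N X) (n : ℕ) :
    IsLocalWith V u N fun m w => binShift (n : ℚ) (fun m => X m w) m := by
  simp only [binShift_natCast]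
  exact IsLocalWith.sum _ (fun _ _ => hX) (fun j => (n.choose j : ℂ)) (fun j => (j : ℤ))

/-- Operators local with `u` that map a `u`-stable set `S` into `O` map it into the largest
subspace of `O` stable under `u`. -/
theorem IsLocalWith.mode_mem {u : V.carrier} {N : ℕ} {X : ℤ → V.carrier → V.carrier}
    (hX : IsLocalWith V u N X) (O : Submodule ℂ V.carrier) {S : Set V.carrier}
    (hS : ∀ w ∈ S, ∀ p, V.mode u p w ∈ S) (hXS : ∀ w ∈ S, ∀ m, X m w ∈ O) {w : V.carrier}
    (hw : w ∈ S) (hw0 : EvZero fun m => X m w) (p m : ℤ) : V.mode u p (X m w) ∈ O := by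
  obtain ⟨K, hK⟩ := hw0
  have key : ∀ n : ℕ, ∀ m : ℤ, K - n ≤ m → ∀ p, V.mode u p (X m w) ∈ O := by
    intro n
    induction n with
    | zero =>
      intro m hm p
      have := hK m (by simpa using hm)
      beta_reduce at this
      rw [this, map_zero]
      exact O.zero_mem
    | succ n ih =>
      intro m hm p
      have h := hX (p - N) m w
      rw [Finset.sum_range_succ'] at h
      have hmem := eq_neg_of_add_eq_zero_right h
      rw [smul_sub] at hmem
      have h2 : ∀ j, ((-1 : ℂ) ^ j * (N.choose j : ℂ)) • (-1 : ℂ) ^ N •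
          X (m + N - j) (V.mode u (p - N + j) w) ∈ O := fun j =>
        O.smul_mem _ (O.smul_mem _ (hXS _ (hS w hw _) _))
      have h3 := eq_add_of_sub_eq hmem
      simp only [pow_zero, Nat.choose_zero_right, Nat.cast_one, mul_one, one_smul,
        Nat.cast_zero, sub_zero, add_zero, sub_add_cancel] at h3
      rw [h3]
      refine O.add_mem (O.neg_mem (O.sum_mem fun j _ => O.smul_mem _ (O.sub_mem ?_ ?_))) ?_
      · exact ih _ (by push_cast at hm ⊢; omega) _
      · exact O.smul_mem _ (hXS _ (hS w hw _) _)
      · exact O.smul_mem _ (hXS _ (by simpa using hS w hw (p - N)) _)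
  exact key (K - m).toNat m (by omega) p

variable (V)

/-- The operator `∑_{j ≤ J} c_j Res_z Y(a_j, z) (1 + z)^{J - j} z^n`. -/
def combo (a : ℕ → V.carrier) (c : ℕ → ℂ) (J : ℕ) (n : ℤ) (w : V.carrier) : V.carrier :=
  ∑ j ∈ Finset.range (J + 1), c j • binShift ((J - j : ℕ) : ℚ) (fun m => V.mode (a j) m w) n

variable {V} {a : ℕ → V.carrier} {O : Submodule ℂ V.carrier} {S : Set V.carrier}

theorem evZero_combo (c : ℕ → ℂ) (J : ℕ) (w : V.carrier) :
    EvZero fun n => combo V a c J n w :=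
  EvZero.sum _ fun j _ => ((evZero_mode V (a j) w).binShift _).smul (c j)

theorem exists_isLocalWith_combo (u : V.carrier) (c : ℕ → ℂ) (J : ℕ) :
    ∃ N, IsLocalWith V u N (combo V a c J) := by
  choose K hK using fun j => V.trunc u (a j)
  refine ⟨∑ j ∈ Finset.range (J + 1), (K j).toNat, ?_⟩
  have h := IsLocalWith.sum (V := V) (u := u) (Finset.range (J + 1))
    (X := fun j m w => binShift ((J - j : ℕ) : ℚ) (fun m => V.mode (a j) m w) m)
    (N := ∑ j ∈ Finset.range (J + 1), (K j).toNat)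
    (fun j hj => (isLocalWith_mode V u (a j) fun m hm => hK j m ?_).binShift (J - j)) c
    fun _ => 0
  · simp only [add_zero] at h
    exact h
  · have := Finset.single_le_sum (f := fun j => (K j).toNat) (fun _ _ => Nat.zero_le _) hj
    beta_reduce at this
    omega

theorem lneg1_combo (c : ℕ → ℂ) (J : ℕ) (n : ℤ) (w : V.carrier) :
    V.mode V.conformal 0 (combo V a c (J + 1) n w) -
      combo V a c (J + 1) n (V.mode V.conformal 0 w) =
      -(n : ℂ) • combo V a c (J + 1) (n - 1) w -
        combo V a (fun j => c j * ((J + 1 - j : ℕ) : ℂ)) J n w := by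
  have h : ∀ j, V.mode V.conformal 0 (binShift ((J + 1 - j : ℕ) : ℚ)
      (fun m => V.mode (a j) m w) n) - binShift ((J + 1 - j : ℕ) : ℚ)
      (fun m => V.mode (a j) m (V.mode V.conformal 0 w)) n =
      -(n : ℂ) • binShift ((J + 1 - j : ℕ) : ℚ) (fun m => V.mode (a j) m w) (n - 1) -
      ((J + 1 - j : ℕ) : ℂ) • binShift (((J + 1 - j : ℕ) : ℚ) - 1)
        (fun m => V.mode (a j) m w) n := by
    intro j
    have hf := evZero_mode V (a j) w
    have hf' := evZero_mode V (a j) (V.mode V.conformal 0 w)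
    have h1 := binShift_neg_mul_pred ((J + 1 - j : ℕ) : ℚ) hf n
    rw [Rat.cast_natCast] at h1
    rw [← h1, map_binShift _ _ hf, sub_eq_iff_eq_add, ← binShift_fun_add _ _ hf']
    · congr 1
      funext m
      rw [← lneg1_commutator, sub_add_cancel]
    · obtain ⟨K, hK⟩ := hf
      refine ⟨K + 1, fun m hm => ?_⟩
      have := hK (m - 1) (by omega)
      beta_reduce at this ⊢
      rw [this, smul_zero]
  rw [combo, combo, combo, map_sum, ← Finset.sum_sub_distrib]
  simp only [map_smul, ← smul_sub, h]
  simp only [smul_sub, Finset.sum_sub_distrib]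
  congr 1
  · rw [Finset.smul_sum]
    exact Finset.sum_congr rfl fun j _ => smul_comm _ _ _
  · rw [Finset.sum_range_succ, Nat.sub_self, Nat.cast_zero, zero_smul, smul_zero, add_zero, combo]
    refine Finset.sum_congr rfl fun j hj => ?_
    have hj := Finset.mem_range.1 hj
    rw [smul_smul, show J + 1 - j = J - j + 1 by omega, Nat.cast_succ (R := ℚ), add_sub_cancel_right]

theorem combo_pred_mem (hS : ∀ w ∈ S, ∀ p, V.mode V.conformal p w ∈ S) {c : ℕ → ℂ} {J : ℕ}
    (h : ∀ w ∈ S, ∀ n, combo V a c (J + 1) n w ∈ O) {w : V.carrier} (hw : w ∈ S) (n : ℤ) :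
    combo V a (fun j => c j * ((J + 1 - j : ℕ) : ℂ)) J n w ∈ O := by
  obtain ⟨N, hN⟩ := exists_isLocalWith_combo (a := a) V.conformal c (J + 1)
  have h1 := hN.mode_mem O hS h hw (evZero_combo c (J + 1) w) 0 n
  have h2 := O.sub_mem h1 (h _ (hS w hw 0) n)
  rw [lneg1_combo] at h2
  exact (O.sub_mem_iff_right (O.smul_mem _ (h w hw _))).1 h2

theorem mode_one_mem_of_combo_mem (hS : ∀ w ∈ S, ∀ p, V.mode V.conformal p w ∈ S) (J : ℕ) :
    ∀ {c : ℕ → ℂ}, c 1 ≠ 0 → (∀ w ∈ S, ∀ n, combo V a c (J + 1) n w ∈ O) →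
      ∀ w ∈ S, ∀ n, V.mode (a 1) n w ∈ O := by
  induction J with
  | zero =>
    intro c hc h w hw n
    have h0 : ∀ m, c 0 • V.mode (a 0) m w ∈ O := fun m => by
      simpa [combo, binShift_zero] using combo_pred_mem hS h hw m
    have h1 := h w hw n
    simp only [combo, zero_add, Finset.sum_range_succ, Finset.sum_range_zero, Nat.sub_zero,
      Nat.sub_self, Nat.cast_one, Nat.cast_zero, binShift_one, binShift_zero, smul_add] at h1
    exact (O.smul_mem_iff hc).1 ((O.add_mem_iff_right (O.add_mem (h0 _) (h0 _))).1 h1)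
  | succ J ih =>
    intro c hc h
    refine ih (c := fun j => c j * ((J + 1 + 1 - j : ℕ) : ℂ)) ?_
      fun w hw n => combo_pred_mem hS h hw n
    refine mul_ne_zero hc ?_
    rw [Nat.add_sub_cancel]
    exact_mod_cast Nat.succ_ne_zero J

end ideal

/-! ### Twisted sectors -/

section twisted

variable (V : VOA) (g : VOAAut V) {T r : ℕ}

theorem mem_eigSpace {v : V.carrier} : v ∈ eigSpace V g T r ↔ g.lin v =
    Complex.exp (-(2 * (Real.pi : ℂ) * Complex.I * (r : ℂ)) / (T : ℂ)) • v := Iff.rfl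

theorem mem_eigSpace_zero {v : V.carrier} : v ∈ eigSpace V g T 0 ↔ g.lin v = v := by
  rw [mem_eigSpace]
  simp

theorem mode_mem_eigSpace {u v : V.carrier} (hu : u ∈ eigSpace V g T 0)
    (hv : v ∈ eigSpace V g T r) (m : ℤ) : V.mode u m v ∈ eigSpace V g T r := by
  rw [mem_eigSpace] at hv ⊢
  rw [g.map_mode, (mem_eigSpace_zero V g).1 hu, hv, map_smul]

theorem conformal_mem_eigSpace : V.conformal ∈ eigSpace V g T 0 :=
  (mem_eigSpace_zero V g).2 g.map_conformal

theorem natCast_div_ne_intCast (hr : 0 < r) (hrT : r < T) (n : ℤ) : (r : ℚ) / T ≠ n := by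
  intro h
  have hT : (0 : ℚ) < T := by exact_mod_cast hr.trans hrT
  have h0 : (0 : ℚ) < n := by rw [← h]; positivity
  have h1 : (n : ℚ) < 1 := by
    rw [← h, div_lt_one hT]
    exact_mod_cast hrT
  have h0' : 0 < n := by exact_mod_cast h0
  have h1' : n < 1 := by exact_mod_cast h1
  omega

variable {V g} {k : ℤ} {u : V.carrier}

theorem binShift_mem_Ogn (l i : ℕ) (hrT : r < T) (hk : u ∈ V.wtSpace k)
    (hu : u ∈ eigSpace V g T r) (v : V.carrier) :
    binShift ((k : ℚ) - 1 + (deltaI T i r : ℚ) + (l : ℚ) + (r : ℚ) / (T : ℚ))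
      (fun m => V.mode u m v)
      (-(2 * (l : ℤ) + (deltaI T i r : ℤ) + (deltaI T i (T - r) : ℤ))) ∈ Ogn V g T l i := by
  rw [← res_eq_binShift]
  exact Submodule.subset_span (Or.inr ⟨r, hrT, k, u, v, hk, hu, rfl⟩)

/-- If the pole order in `u ∘_{g,n} v` is positive, the twisted sector lies in `O_{g,n}(V)`. -/
theorem mem_Ogn_of_pos {l i : ℕ} (hr : 0 < r) (hrT : r < T)
    (hpos : 0 < 2 * l + deltaI T i r + deltaI T i (T - r)) (hk : u ∈ V.wtSpace k)
    (hu : u ∈ eigSpace V g T r) : u ∈ Ogn V g T l i := by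
  obtain ⟨b, hb⟩ := Nat.exists_eq_add_of_lt hpos
  rw [zero_add] at hb
  have hb' : (2 * (l : ℤ) + (deltaI T i r : ℤ) + (deltaI T i (T - r) : ℤ)) = b + 1 := by
    exact_mod_cast hb
  have h1 := binShift_mem_Ogn l i hrT hk hu V.vacuum
  rw [hb'] at h1
  have h2 := binShift_swap_mem V g T l i V.vacuum_wt hk
    ((k : ℚ) - 1 + (deltaI T i r : ℚ) + (l : ℚ) + (r : ℚ) / (T : ℚ)) (-(b + 1))
  have h3 := (Submodule.sub_mem_iff_right _ h1).1 h2
  set γ : ℚ := ((0 : ℤ) : ℚ) + k - 2 - ((-(b + 1) : ℤ) : ℚ) -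
    ((k : ℚ) - 1 + (deltaI T i r : ℚ) + (l : ℚ) + (r : ℚ) / (T : ℚ)) with hγ
  have h4 : binShift γ (fun m => V.mode V.vacuum m u) (-(b + 1)) =
      ((qchoose γ b : ℚ) : ℂ) • u := by
    rw [binShift, finsum_eq_single _ b]
    · rw [V.vacuum_mode, if_pos (by ring)]
    · intro j hj
      rw [V.vacuum_mode, if_neg (by omega), smul_zero]
  rw [h4, smul_smul] at h3
  refine (Submodule.smul_mem_iff _ (mul_ne_zero (zpow_ne_zero _ (by norm_num)) ?_)).1 h3
  have : qchoose γ b ≠ 0 := by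
    refine qchoose_ne_zero (fun n hn => ?_) b
    refine natCast_div_ne_intCast hr hrT (b - deltaI T i r - l - n) ?_
    rw [hγ] at hn
    push_cast at hn ⊢
    linear_combination -hn
  exact_mod_cast this

theorem deltaI_zero (T i : ℕ) : deltaI T i 0 = 1 := by simp [deltaI]

theorem deltaI_self (T i : ℕ) : deltaI T i T = 1 := by simp [deltaI]

theorem binShift_fixed_mem (i : ℕ) (hT : 0 < T) (x : V.carrier) (n : ℕ) :
    ∀ {k : ℤ} {b : V.carrier}, b ∈ V.wtSpace k → b ∈ eigSpace V g T 0 →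
      binShift k (fun m => V.mode b m x) (-2 - n) ∈ Ogn V g T 0 i := by
  induction n with
  | zero =>
    intro k b hk hb
    have h := binShift_mem_Ogn 0 i hT hk hb x
    simp only [Nat.sub_zero, deltaI_zero, deltaI_self] at h
    norm_num at h ⊢
    exact h
  | succ n ih =>
    intro k b hk hb
    have h := ih (lneg1_mem_wtSpace V hk) (mode_mem_eigSpace V g (conformal_mem_eigSpace V g) hb 0)
    have hf := evZero_mode V b x
    have e : (fun m => V.mode (V.mode V.conformal 0 b) m x) =
        fun m : ℤ => -(m : ℂ) • V.mode b (m - 1) x := by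
      funext m
      rw [V.Lneg1_mode]
      rfl
    have e1 : ((k + 1 : ℤ) : ℚ) = 1 + k := by push_cast; ring
    rw [e, binShift_neg_mul_pred _ hf, e1, add_sub_cancel_left, binShift_add _ _ hf,
      binShift_one, sub_add_cancel] at h
    have h0 := ih hk hb
    have h1 := (Submodule.sub_mem_iff_left _ (Submodule.smul_mem _ _ h0)).1 h
    have h2 := (Submodule.smul_mem_iff _ ?_).1 h1
    · have h3 := (Submodule.add_mem_iff_left _ h0).1 h2
      rwa [show -2 - ((n + 1 : ℕ) : ℤ) = -2 - n - 1 by push_cast; ring]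
    · rw [neg_ne_zero]
      have : (-2 - n : ℤ) ≠ 0 := by omega
      exact_mod_cast this

/-- If the pole order in `u ∘_{g,n} v` vanishes, `O_{g,n}(V)` contains all modes of `ω` on the
twisted sector. -/
theorem mode_conformal_mem_of_zero {i : ℕ} (hr : 0 < r) (hrT : r < T) (h0 : deltaI T i r = 0)
    (h0' : deltaI T i (T - r) = 0) (hk : u ∈ V.wtSpace k) (hu : u ∈ eigSpace V g T r) (n : ℤ) :
    V.mode V.conformal n u ∈ Ogn V g T 0 i := by
  have hT : 0 < T := hr.trans hrT
  set O := Ogn V g T 0 i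
  set ρ : ℚ := (r : ℚ) / T with hρ
  let S : Set V.carrier := {w | ∃ k : ℤ, w ∈ V.wtSpace k ∧ w ∈ eigSpace V g T r}
  have hS : ∀ w ∈ S, ∀ p, V.mode V.conformal p w ∈ S := by
    rintro w ⟨k, hw, hw'⟩ p
    exact ⟨_, V.mode_grading 2 k p _ _ V.conformal_wt hw,
      mode_mem_eigSpace V g (conformal_mem_eigSpace V g) hw' p⟩
  obtain ⟨K, hK⟩ := V.trunc V.conformal V.conformal
  obtain ⟨J, hJ⟩ : ∃ J : ℕ, ∀ m : ℤ, (J + 4 : ℕ) ≤ m → V.mode V.conformal m V.conformal = 0 :=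
    ⟨K.toNat, fun m hm => hK m (by push_cast at hm; omega)⟩
  let a : ℕ → V.carrier := fun j => V.mode V.conformal j V.conformal
  have ha : ∀ j : ℕ, a j ∈ V.wtSpace (3 - j) ∧ a j ∈ eigSpace V g T 0 := fun j =>
    ⟨by
      have := V.mode_grading 2 2 j _ _ V.conformal_wt V.conformal_wt
      rwa [show (2 + 2 - (j : ℤ) - 1) = 3 - j by ring] at this,
    mode_mem_eigSpace V g (conformal_mem_eigSpace V g) (conformal_mem_eigSpace V g) j⟩
  let d : ℕ → ℂ := fun j => ((qchoose (1 - ρ) j : ℚ) : ℂ)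
  -- the degenerate circle product with exponents reversed
  have hD : ∀ w ∈ S, binShift (1 - ρ) (fun m => V.mode V.conformal m w) 0 ∈ O := by
    rintro w ⟨k, hw, hw'⟩
    have h1 := binShift_mem_Ogn 0 i hrT hw hw' V.conformal
    rw [h0, h0'] at h1
    have h2 := binShift_swap_mem V g T 0 i hw V.conformal_wt (1 - ρ) 0
    rw [show (k : ℚ) + ((2 : ℤ) : ℚ) - 2 - ((0 : ℤ) : ℚ) - (1 - ρ) =
      (k : ℚ) - 1 + ((0 : ℕ) : ℚ) + ((0 : ℕ) : ℚ) + ρ by push_cast; ring] at h2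
    exact (Submodule.sub_mem_iff_left _ (Submodule.smul_mem _ _ (by simpa using h1))).1 h2
  have hcomm : ∀ w ∈ S, ∀ m : ℤ,
      V.mode V.conformal m (binShift (1 - ρ) (fun m => V.mode V.conformal m w) 0) +
        ∑ j ∈ Finset.range (J + 4), d j • binShift (1 - ρ - j) (fun m => V.mode (a j) m w) m ∈
        O := by
    intro w hw m
    have hev : ∀ j : ℕ, EvZero fun p : ℤ =>
        ((qchoose (p : ℚ) j : ℚ) : ℂ) • V.mode (a j) (p + m - j) w := fun j => by
      obtain ⟨L, hL⟩ := V.trunc (a j) w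
      exact ⟨L - m + j, fun p hp => by
        beta_reduce
        rw [hL _ (by omega), smul_zero]⟩
    have h1 := hD _ (hS w hw m)
    have hww := evZero_mode V V.conformal w
    have hφ : EvZero fun p => V.mode V.conformal m (V.mode V.conformal p w) := by
      obtain ⟨L, hL⟩ := hww
      refine ⟨L, fun p hp => ?_⟩
      have := hL p hp
      beta_reduce at this ⊢
      rw [this, map_zero]
    convert h1 using 1
    rw [map_binShift _ _ hww]
    have e : ∀ j ∈ Finset.range (J + 4), d j • binShift (1 - ρ - j)
        (fun m => V.mode (a j) m w) m = binShift (1 - ρ) (fun p : ℤ =>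
          ((qchoose (p : ℚ) j : ℚ) : ℂ) • V.mode (a j) (p + m - j) w) 0 := fun j _ =>
      (binShift_choose_smul (1 - ρ) j (evZero_mode V (a j) w) m).symm
    rw [Finset.sum_congr rfl e, ← binShift_fun_sum _ _ (fun j _ => hev j),
      ← binShift_fun_add _ hφ (EvZero.sum _ fun j _ => hev j)]
    congr 1
    funext p
    rw [← mode_commutator V V.conformal V.conformal w p m hJ, add_sub_cancel]
  have hcombo3 : ∀ w ∈ S, ∀ m,
      ∑ j ∈ Finset.range (J + 4), d j • binShift (3 - j) (fun m => V.mode (a j) m w) m ∈ O := by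
    intro w hw
    have hfj : ∀ j, EvZero fun m => V.mode (a j) m w := fun j => evZero_mode V (a j) w
    have hev : ∀ j (α : ℚ), EvZero fun m => d j • binShift α (fun m => V.mode (a j) m w) m :=
      fun j α => ((hfj j).binShift α).smul (d j)
    have hlow : ∀ m ≤ -2, ∀ {k : ℤ} {b : V.carrier}, b ∈ V.wtSpace k → b ∈ eigSpace V g T 0 →
        ∀ x, binShift k (fun m => V.mode b m x) m ∈ O := by
      intro m hm k b hb hb' x
      have := binShift_fixed_mem i hT x (-2 - m).toNat hb hb'
      rwa [show -2 - ((-2 - m).toNat : ℤ) = m by omega] at this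
    refine mem_of_binShift_mem (α := -ρ) (fun n hn => natCast_div_ne_intCast hr hrT (-n) ?_) O
      (EvZero.sum _ fun j _ => hev j _) (A := -2) (B := -2) (fun m hm => ?_) fun m hm => ?_
    · push_cast
      rw [← hn, neg_neg]
    · refine O.sum_mem fun j _ => O.smul_mem _ ?_
      have := hlow m hm (ha j).1 (ha j).2 w
      push_cast at this
      exact this
    · set x := binShift (1 - ρ) (fun m => V.mode V.conformal m w) 0 with hx
      have h1 := binShift_mem 2 O (n := m)
        ((evZero_mode V V.conformal x).add
          (EvZero.sum (Finset.range (J + 4)) fun j _ => hev j (1 - ρ - j)))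
        fun p _ => hcomm w hw p
      have hsum := EvZero.sum (Finset.range (J + 4)) fun j _ => hev j (1 - ρ - j)
      rw [binShift_fun_add _ (evZero_mode V V.conformal x) hsum] at h1
      have h2 := hlow m hm V.conformal_wt (conformal_mem_eigSpace V g (T := T)) x
      rw [Int.cast_ofNat] at h2
      have h3 := (O.add_mem_iff_right h2).1 h1
      rw [binShift_fun_sum _ _ (fun j _ => hev j _)] at h3 ⊢
      convert h3 using 2 with j
      rw [binShift_fun_smul _ _ ((hfj j).binShift _), binShift_fun_smul _ _ ((hfj j).binShift _),
        ← binShift_add _ _ (hfj j), ← binShift_add _ _ (hfj j)]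
      congr 2
      ring
  have hcombo : ∀ w ∈ S, ∀ m, combo V a d (J + 2 + 1) m w ∈ O := by
    intro w hw m
    have hfj : ∀ j, EvZero fun m => V.mode (a j) m w := fun j => evZero_mode V (a j) w
    have hev : ∀ j (α : ℚ), EvZero fun m => d j • binShift α (fun m => V.mode (a j) m w) m :=
      fun j α => ((hfj j).binShift α).smul (d j)
    have h := binShift_mem J O (n := m) (EvZero.sum _ fun j _ => hev j _)
      fun m _ => hcombo3 w hw m
    rw [binShift_fun_sum _ _ (fun j _ => hev j _)] at h
    convert h using 1
    rw [combo]
    refine Finset.sum_congr rfl fun j hj => ?_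
    have hj := Finset.mem_range.1 hj
    rw [binShift_fun_smul _ _ ((hfj j).binShift _), ← binShift_add _ _ (hfj j),
      Nat.cast_sub (by omega)]
    congr 2
    push_cast
    ring
  have hd : d 1 ≠ 0 := by
    have : qchoose (1 - ρ) 1 ≠ 0 := qchoose_ne_zero (fun n hn =>
      natCast_div_ne_intCast hr hrT (1 - n) (by push_cast; linear_combination -hn)) 1
    exact Rat.cast_ne_zero.2 this
  have h := mode_one_mem_of_combo_mem hS (J + 2) hd hcombo u ⟨k, hk, hu⟩ n
  have ha1 : a 1 = (2 : ℂ) • V.conformal := by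
    simpa [a] using V.L0_grading 2 V.conformal V.conformal_wt
  rw [ha1, map_smul, Pi.smul_apply, LinearMap.smul_apply] at h
  exact (O.smul_mem_iff two_ne_zero).1 h

theorem mode_conformal_mem (l i : ℕ) (hr : 0 < r) (hrT : r < T) (hk : u ∈ V.wtSpace k)
    (hu : u ∈ eigSpace V g T r) (n : ℤ) : V.mode V.conformal n u ∈ Ogn V g T l i := by
  rcases Nat.eq_zero_or_pos (2 * l + deltaI T i r + deltaI T i (T - r)) with h | h
  · obtain rfl : l = 0 := by omega
    exact mode_conformal_mem_of_zero hr hrT (by omega) (by omega) hk hu n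
  · exact mem_Ogn_of_pos hr hrT h (V.mode_grading 2 k n _ _ V.conformal_wt hk)
      (mode_mem_eigSpace V g (conformal_mem_eigSpace V g) hu n)

end twisted

/-! ### Decomposition into homogeneous components and sectors -/

section decomposition

variable (V : VOA) (g : VOAAut V) {T : ℕ}

theorem proj_mem (k : ℤ) (v : V.carrier) : V.proj k v ∈ V.wtSpace k :=
  SetLike.coe_mem _

theorem proj_of_mem {k : ℤ} {v : V.carrier} (hv : v ∈ V.wtSpace k) : V.proj k v = v :=
  DirectSum.decompose_of_mem_same _ hv

theorem proj_of_mem_ne {k j : ℤ} {v : V.carrier} (hv : v ∈ V.wtSpace k) (h : k ≠ j) :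
    V.proj j v = 0 :=
  DirectSum.decompose_of_mem_ne _ hv h

theorem exists_sum_proj (v : V.carrier) :
    ∃ s : Finset ℤ, (∀ k ∉ s, V.proj k v = 0) ∧ ∑ k ∈ s, V.proj k v = v := by
  classical
  refine ⟨(DirectSum.decompose V.wtSpace v).support, fun k hk => ?_,
    DirectSum.sum_support_decompose V.wtSpace v⟩
  rw [DFinsupp.notMem_support_iff] at hk
  rw [VOA.proj, hk, ZeroMemClass.coe_zero]

theorem pow_lin_mem_wtSpace {k : ℤ} {v : V.carrier} (hv : v ∈ V.wtSpace k) (t : ℕ) :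
    (g.lin ^ t) v ∈ V.wtSpace k := by
  induction t with
  | zero => simpa using hv
  | succ t ih =>
    rw [pow_succ', LinearEquiv.mul_apply]
    exact (g.map_wt k _).1 ih

theorem eigProj_mem_wtSpace (r : ℕ) {k : ℤ} {v : V.carrier} (hv : v ∈ V.wtSpace k) :
    eigProj V g T r v ∈ V.wtSpace k :=
  Submodule.smul_mem _ _ (Submodule.sum_mem _ fun t _ =>
    Submodule.smul_mem _ _ (pow_lin_mem_wtSpace V g hv t))

theorem eigProj_mem_eigSpace (hT : 0 < T) (hg : g.lin ^ T = 1) (r : ℕ) (v : V.carrier) :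
    eigProj V g T r v ∈ eigSpace V g T r := by
  have hT' : (T : ℂ) ≠ 0 := by exact_mod_cast hT.ne'
  rw [mem_eigSpace, eigProj, map_smul, map_sum, smul_comm]
  congr 1
  set F : ℕ → V.carrier := fun t =>
    Complex.exp (2 * (Real.pi : ℂ) * Complex.I * r * t / T) • (g.lin ^ t) v with hF
  have h1 : ∀ t : ℕ, g.lin (F t) =
      Complex.exp (-(2 * (Real.pi : ℂ) * Complex.I * r) / T) • F (t + 1) := by
    intro t
    rw [hF]
    beta_reduce
    rw [map_smul, smul_smul, ← Complex.exp_add, pow_succ', LinearEquiv.mul_apply]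
    congr 2
    push_cast
    ring
  have h2 : F T = F 0 := by
    rw [hF]
    beta_reduce
    rw [hg, pow_zero, mul_div_assoc, div_self hT', mul_one, Nat.cast_zero, mul_zero, zero_div,
      Complex.exp_zero, mul_comm, Complex.exp_nat_mul_two_pi_mul_I]
  have h3 : ∑ t ∈ Finset.range T, F (t + 1) = ∑ t ∈ Finset.range T, F t := by
    have := Finset.sum_range_succ F T
    rw [Finset.sum_range_succ', h2] at this
    exact add_right_cancel this
  rw [← h3, Finset.smul_sum]
  exact Finset.sum_congr rfl fun t _ => h1 t

theorem sum_eigProj (hT : 0 < T) (v : V.carrier) :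
    ∑ r ∈ Finset.range T, eigProj V g T r v = v := by
  have hT' : (T : ℂ) ≠ 0 := by exact_mod_cast hT.ne'
  have hζ := Complex.isPrimitiveRoot_exp T hT.ne'
  set ζ := Complex.exp (2 * (Real.pi : ℂ) * Complex.I / T) with hζdef
  have hexp : ∀ r t : ℕ, Complex.exp (2 * (Real.pi : ℂ) * Complex.I * r * t / T) =
      (ζ ^ t) ^ r := by
    intro r t
    rw [hζdef, ← Complex.exp_nat_mul, ← Complex.exp_nat_mul]
    congr 1
    ring
  simp only [eigProj, ← Finset.smul_sum]
  rw [Finset.sum_comm]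
  simp only [← Finset.sum_smul, hexp]
  rw [Finset.sum_eq_single 0]
  · simp [smul_smul, hT']
  · intro t ht h0
    have ht := Finset.mem_range.1 ht
    have h1 : ζ ^ t ≠ 1 := hζ.pow_ne_one_of_pos_of_lt h0 ht
    have h2 : (ζ ^ t - 1) * ∑ r ∈ Finset.range T, (ζ ^ t) ^ r = 0 := by
      rw [mul_geom_sum, ← pow_mul, mul_comm, pow_mul, hζ.pow_eq_one, one_pow, sub_self]
    rw [(mul_eq_zero.1 h2).resolve_left (sub_ne_zero.2 h1), zero_smul]
  · intro h
    exact absurd (Finset.mem_range.2 hT) h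

theorem eigProj_zero_of_mem (hT : 0 < T) {v : V.carrier} (hv : v ∈ eigSpace V g T 0) :
    eigProj V g T 0 v = v := by
  have hT' : (T : ℂ) ≠ 0 := by exact_mod_cast hT.ne'
  have h : ∀ t : ℕ, (g.lin ^ t) v = v := by
    intro t
    induction t with
    | zero => simp
    | succ t ih => rw [pow_succ', LinearEquiv.mul_apply, ih, (mem_eigSpace_zero V g).1 hv]
  simp [eigProj, h, ← Nat.cast_smul_eq_nsmul ℂ, smul_smul, hT']

theorem eigProj_map_zero (r : ℕ) : eigProj V g T r (0 : V.carrier) = 0 := by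
  simp [eigProj]

theorem starFor_sum_right {ι : Type*} (s : Finset ι) (l : ℕ) (k : ℤ) (u : V.carrier)
    (v : ι → V.carrier) : starFor V l k u (∑ j ∈ s, v j) = ∑ j ∈ s, starFor V l k u (v j) := by
  simp only [starFor, res_eq_binShift, map_sum]
  rw [Finset.sum_comm]
  refine Finset.sum_congr rfl fun m _ => ?_
  rw [binShift_fun_sum _ _ fun j _ => evZero_mode V u (v j), Finset.smul_sum]

theorem starFor_zero_left (l : ℕ) (k : ℤ) (v : V.carrier) : starFor V l k 0 v = 0 := by
  simp [starFor, VOA.res]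

theorem starFor_mem (O : Submodule ℂ V.carrier) (l : ℕ) (k : ℤ) {u v : V.carrier}
    (h : ∀ m, V.mode u m v ∈ O) : starFor V l k u v ∈ O := by
  refine O.sum_mem fun m _ => O.smul_mem _ ?_
  rw [res_eq_binShift]
  exact binShift_mem _ O (evZero_mode V u v) fun m _ => h m

theorem starMul_conformal (hT : 0 < T) (l : ℕ) (v : V.carrier) :
    starMul V g T l V.conformal v = starFor V l 2 V.conformal v := by
  rw [starMul, finsum_eq_single _ 2]
  · rw [proj_of_mem V V.conformal_wt,
      eigProj_zero_of_mem V g hT (conformal_mem_eigSpace V g)]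
  · intro k hk
    rw [proj_of_mem_ne V V.conformal_wt hk.symm, eigProj_map_zero, starFor_zero_left]

end decomposition

theorem starFor_conformal_sub_mem (V : VOA) (g : VOAAut V) {T : ℕ} (hT : 0 < T)
    (hg : g.lin ^ T = 1) (l i : ℕ) {k : ℤ} {w : V.carrier} (hw : w ∈ V.wtSpace k) :
    starFor V l 2 V.conformal w - starFor V l k (eigProj V g T 0 w) V.conformal
      ∈ Ogn V g T l i := by
  have hsum : starFor V l 2 V.conformal w =
      ∑ r ∈ Finset.range T, starFor V l 2 V.conformal (eigProj V g T r w) := by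
    rw [← starFor_sum_right, sum_eigProj V g hT]
  rw [hsum, ← Finset.add_sum_erase _ _ (Finset.mem_range.2 hT), add_sub_right_comm]
  refine Submodule.add_mem _
    (starFor_comm_mem V g T l i (eigProj_mem_wtSpace V g 0 hw)) ?_
  refine Submodule.sum_mem _ fun r hr => ?_
  obtain ⟨hr0, hrT⟩ := Finset.mem_erase.1 hr
  exact starFor_mem V _ l 2 fun m =>
    mode_conformal_mem l i (Nat.pos_of_ne_zero hr0) (Finset.mem_range.1 hrT)
      (eigProj_mem_wtSpace V g r hw) (eigProj_mem_eigSpace V g hT hg r w) m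

theorem starMul_eq_sum (V : VOA) (g : VOAAut V) (T l : ℕ) (s : Finset ℤ) {u : V.carrier}
    (hs : ∀ k ∉ s, V.proj k u = 0) (v : V.carrier) :
    starMul V g T l u v = ∑ k ∈ s, starFor V l k (eigProj V g T 0 (V.proj k u)) v := by
  refine finsum_eq_sum_of_support_subset _ fun k hk => ?_
  by_contra h
  exact hk (by simp only [hs k h, eigProj_map_zero, starFor_zero_left])

/-- **Theorem 2.4 (iii).** The image `ω + O_{g,n}(V)` of the conformal vector is
a central element of `A_{g,n}(V)`: `ω *_{g,n} v ≡ v *_{g,n} ω mod O_{g,n}(V)`. -/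
theorem omega_central (V : VOA) (g : VOAAut V) (T : ℕ) (hT : 0 < T)
    (hg : g.lin ^ T = 1) (l i : ℕ) (hi : i ≤ T - 1) :
    ∀ v : V.carrier,
      starMul V g T l V.conformal v - starMul V g T l v V.conformal
        ∈ Ogn V g T l i := by
  intro v
  obtain ⟨s, hs, hv⟩ := exists_sum_proj V v
  have h1 : starMul V g T l V.conformal v =
      ∑ k ∈ s, starFor V l 2 V.conformal (V.proj k v) := by
    rw [starMul_conformal V g hT, ← starFor_sum_right, hv]
  rw [h1, starMul_eq_sum V g T l s hs, ← Finset.sum_sub_distrib]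
  exact Submodule.sum_mem _ fun k _ =>
    starFor_conformal_sub_mem V g hT hg l i (proj_mem V k v)

end DLM
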